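/- If G is a (2θ(G) − 1)-connected graph with girth at least 6, then χ_o(G) ≤ 6θ(G). -/

import Mathlib

open SimpleGraph

/-- The degree of a vertex, as the cardinality of its neighbor set. -/
noncomputable def deg {V : Type} (G : SimpleGraph V) (v : V) : ℕ := (G.neighborSet v).ncard

/-- `H` is a minor of `G`, via branch sets. -/
def IsMinor {W V : Type} (H : SimpleGraph W) (G : SimpleGraph V) : Prop :=
  ∃ B : W → Set V,
    (∀ w, (B w).Nonempty) ∧
    (∀ w, (G.induce (B w)).Connected) ∧
    (Pairwise fun w₁ w₂ => Disjoint (B w₁) (B w₂)) ∧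
    (∀ w₁ w₂, H.Adj w₁ w₂ → ∃ v₁ ∈ B w₁, ∃ v₂ ∈ B w₂, G.Adj v₁ v₂)

/-- A graph is planar iff it has no `K₅` and no `K₃,₃` minor (Wagner's theorem). -/
def IsPlanar {V : Type} (G : SimpleGraph V) : Prop :=
  ¬ IsMinor (completeGraph (Fin 5)) G ∧
  ¬ IsMinor (completeBipartiteGraph (Fin 3) (Fin 3)) G

/-- `G` has thickness at most `t`: its edge set partitions into `t` planar subgraphs. -/
def ThicknessLE {V : Type} (G : SimpleGraph V) (t : ℕ) : Prop :=
  ∃ c : Sym2 V → Fin t, ∀ i : Fin t,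
    IsPlanar (SimpleGraph.fromEdgeSet {e | e ∈ G.edgeSet ∧ c e = i})

/-- The thickness of a graph. -/
noncomputable def thickness {V : Type} (G : SimpleGraph V) : ℕ :=
  sInf {t | ThicknessLE G t}

/-- `φ` is an odd coloring of `G` with `k` colors. -/
def IsOddColoring {V : Type} (G : SimpleGraph V) {k : ℕ} (φ : V → Fin k) : Prop :=
  (∀ ⦃u v⦄, G.Adj u v → φ u ≠ φ v) ∧
  ∀ v : V, (G.neighborSet v).Nonempty →
    ∃ c : Fin k, Odd ({u | u ∈ G.neighborSet v ∧ φ u = c}.ncard)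

/-- The odd chromatic number of `G`. -/
noncomputable def oddChrom {V : Type} (G : SimpleGraph V) : ℕ :=
  sInf {k | ∃ φ : V → Fin k, IsOddColoring G φ}

/-- `G` is odd `k⁺`-critical. -/
def OddCritical {V : Type} (G : SimpleGraph V) (k : ℕ) : Prop :=
  k ≤ oddChrom G ∧ ∀ H : G.Subgraph, H ≠ ⊤ → oddChrom H.coe < k

/-- A vertex is `n`-easy if its degree is odd or it has a neighbor of degree `2i`, `1 ≤ i ≤ n`. -/
def NEasy {V : Type} (G : SimpleGraph V) (n : ℕ) (v : V) : Prop :=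
  Odd (deg G v) ∨ ∃ u ∈ G.neighborSet v, ∃ i, 1 ≤ i ∧ i ≤ n ∧ deg G u = 2 * i


/-- `G` is `k`-connected: more than `k` vertices, and removing fewer than `k` vertices
leaves a connected graph. -/
def IsKConnected {V : Type} [Fintype V] (G : SimpleGraph V) (k : ℕ) : Prop :=
  k < Fintype.card V ∧
  ∀ S : Set V, S.ncard < k → (G.induce Sᶜ).Connected

section OddColoring

variable {V : Type} [Fintype V]

open Classical in
/-- The cost of colouring `v` last among `R`: its neighbors in `R`, together with the
even-degree neighbors all of whose neighbors lie in `R`. -/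
noncomputable def coloringCost (G : SimpleGraph V) (R : Finset V) (v : V) : ℕ :=
  (R.filter fun u => G.Adj v u).card +
    (Finset.univ.filter fun u => G.Adj v u ∧ Even (deg G u) ∧ ∀ w, G.Adj u w → w ∈ R).card

open Classical in
theorem exists_odd_fiber {W : Type} {k : ℕ} (s : Finset W) (hs : Odd s.card) (φ : W → Fin k) :
    ∃ c, Odd (s.filter fun u => φ u = c).card := by
  by_contra! h
  have h1 := Finset.card_eq_sum_card_fiberwise (f := φ) (s := s) (t := Finset.univ) (by simp)
  have h2 : Even s.card := by
    rw [h1]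
    exact Finset.even_sum _ fun c _ => Nat.not_odd_iff_even.1 (h c)
  exact (Nat.not_even_iff_odd.2 hs) h2

open Classical in
theorem exists_partial_odd_coloring (G : SimpleGraph V) {k : ℕ} (hk : 0 < k)
    (h : ∀ R : Finset V, R.Nonempty → ∃ v ∈ R, coloringCost G R v < k) (R : Finset V) :
    ∃ φ : V → Fin k, (∀ u ∈ R, ∀ v ∈ R, G.Adj u v → φ u ≠ φ v) ∧
      ∀ u, (∃ w, G.Adj u w) → (∀ w, G.Adj u w → w ∈ R) →
        ∃ c, Odd ((Finset.univ.filter fun w => G.Adj u w).filter fun w => φ w = c).card := by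
  induction hn : R.card generalizing R with
  | zero =>
    refine ⟨fun _ => ⟨0, hk⟩, ?_, ?_⟩
    · rw [Finset.card_eq_zero] at hn
      simp [hn]
    · rintro u ⟨w, hw⟩ hR
      rw [Finset.card_eq_zero] at hn
      simpa [hn] using hR w hw
  | succ n ih =>
    obtain ⟨v, hv, hc⟩ := h R (Finset.card_pos.1 (by omega))
    obtain ⟨φ, h1, h2⟩ := ih (R.erase v) (by rw [Finset.card_erase_of_mem hv]; omega)
    have hex : ∀ u, ∃ c : Fin k, G.Adj v u → Even (deg G u) →
        Odd (((Finset.univ.filter fun w => G.Adj u w).erase v).filter fun w => φ w = c).card := by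
      intro u
      by_cases hu : G.Adj v u ∧ Even (deg G u)
      · have : Odd ((Finset.univ.filter fun w => G.Adj u w).erase v).card := by
          rw [Finset.card_erase_of_mem (by simpa using hu.1.symm)]
          have h3 := hu.2
          have h4 : deg G u = (Finset.univ.filter fun w => G.Adj u w).card := by
            rw [deg, ← Set.ncard_coe_finset]
            congr 1
            ext w
            simp
          have h5 : 0 < (Finset.univ.filter fun w => G.Adj u w).card :=
            Finset.card_pos.2 ⟨v, by simpa using hu.1.symm⟩
          rw [h4] at h3
          exact Nat.Even.sub_odd h5 h3 odd_one
        obtain ⟨c, hc⟩ := exists_odd_fiber _ this φ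
        exact ⟨c, fun _ _ => hc⟩
      · exact ⟨⟨0, hk⟩, fun h3 h4 => absurd ⟨h3, h4⟩ hu⟩
    choose f hf using hex
    let F : Finset (Fin k) := (R.filter fun u => G.Adj v u).image φ ∪
      (Finset.univ.filter fun u => G.Adj v u ∧ Even (deg G u) ∧ ∀ w, G.Adj u w → w ∈ R).image f
    have hF : F.card < k := by
      refine lt_of_le_of_lt ?_ hc
      exact (Finset.card_union_le _ _).trans
        (add_le_add Finset.card_image_le Finset.card_image_le)
    obtain ⟨c, hcF⟩ : ∃ c, c ∉ F := by
      by_contra! hall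
      have : F = Finset.univ := by ext; simp [hall]
      rw [this] at hF
      simp at hF
    have hc1 : ∀ u ∈ R, G.Adj v u → φ u ≠ c := by
      rintro u hu huv rfl
      exact hcF (Finset.mem_union_left _ (Finset.mem_image_of_mem _ (by simp [hu, huv])))
    have hc2 : ∀ u, G.Adj v u → Even (deg G u) → (∀ w, G.Adj u w → w ∈ R) → f u ≠ c := by
      rintro u hu he hR rfl
      exact hcF (Finset.mem_union_right _ (Finset.mem_image_of_mem _ (by simpa using ⟨hu, he, hR⟩)))
    refine ⟨Function.update φ v c, ?_, ?_⟩
    · intro a ha b hb hab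
      by_cases hav : a = v
      · subst hav
        have : b ≠ a := hab.ne'
        simpa [this] using (hc1 b hb hab).symm
      · by_cases hbv : b = v
        · subst hbv
          simpa [hav] using hc1 a ha hab.symm
        · simpa [hav, hbv] using h1 a (by simp [ha, hav]) b (by simp [hb, hbv]) hab
    · intro u hne hR
      by_cases huv : G.Adj u v
      · by_cases he : Even (deg G u)
        · refine ⟨f u, ?_⟩
          convert hf u huv.symm he using 2
          ext w
          by_cases hw : w = v
          · subst hw
            simpa using fun _ => (hc2 u huv.symm he hR).symm
          · simp [hw]
        · refine exists_odd_fiber _ ?_ _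
          rw [Nat.not_even_iff_odd, deg, ← Set.ncard_coe_finset] at *
          convert he using 2
          ext w
          simp
      · obtain ⟨d, hd⟩ := h2 u hne (fun w hw => by
          have : w ≠ v := by rintro rfl; exact huv hw
          simp [this, hR w hw])
        refine ⟨d, ?_⟩
        convert hd using 2
        ext w
        by_cases hw : w = v
        · subst hw
          simp [huv]
        · simp [hw]

theorem exists_isOddColoring (G : SimpleGraph V) {k : ℕ} (hk : 0 < k)
    (h : ∀ R : Finset V, R.Nonempty → ∃ v ∈ R, coloringCost G R v < k) :
    ∃ φ : V → Fin k, IsOddColoring G φ := by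
  classical
  obtain ⟨φ, h1, h2⟩ := exists_partial_odd_coloring G hk h Finset.univ
  refine ⟨φ, fun u v huv => h1 u (by simp) v (by simp) huv, ?_⟩
  rintro v ⟨w, hw⟩
  obtain ⟨c, hc⟩ := h2 v ⟨w, hw⟩ (by simp)
  refine ⟨c, ?_⟩
  rw [← Set.ncard_coe_finset] at hc
  convert hc using 2
  ext u
  simp

end OddColoring

section Joined

variable {V : Type} {G : SimpleGraph V}

/-- `x` and `y` are joined by a walk of `G` all of whose vertices lie in `S`. -/
def LinkedIn (G : SimpleGraph V) (S : Set V) (x y : V) : Prop :=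
  ∃ w : G.Walk x y, ∀ z ∈ w.support, z ∈ S

namespace LinkedIn

variable {S T : Set V} {x y z : V}

theorem refl (hx : x ∈ S) : LinkedIn G S x x := ⟨.nil, by simpa using hx⟩

theorem symm (h : LinkedIn G S x y) : LinkedIn G S y x := by
  obtain ⟨w, hw⟩ := h
  exact ⟨w.reverse, by simpa using hw⟩

theorem trans (h : LinkedIn G S x y) (h' : LinkedIn G S y z) : LinkedIn G S x z := by
  obtain ⟨w, hw⟩ := h
  obtain ⟨w', hw'⟩ := h'
  refine ⟨w.append w', fun v hv => ?_⟩
  rcases Walk.mem_support_append_iff _ _ |>.1 hv with hv | hv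
  exacts [hw v hv, hw' v hv]

theorem mono (hST : S ⊆ T) (h : LinkedIn G S x y) : LinkedIn G T x y := by
  obtain ⟨w, hw⟩ := h
  exact ⟨w, fun v hv => hST (hw v hv)⟩

theorem left_mem (h : LinkedIn G S x y) : x ∈ S := by
  obtain ⟨w, hw⟩ := h
  exact hw x w.start_mem_support

theorem right_mem (h : LinkedIn G S x y) : y ∈ S := h.symm.left_mem

theorem of_adj (h : G.Adj x y) (hx : x ∈ S) (hy : y ∈ S) : LinkedIn G S x y :=
  ⟨h.toWalk, by simp [hx, hy]⟩

theorem snoc (h : LinkedIn G S x y) (h' : G.Adj y z) (hz : z ∈ S) : LinkedIn G S x z :=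
  h.trans (of_adj h' h.right_mem hz)

/-- A property that spreads along edges inside `S` spreads along walks inside `S`. -/
theorem induct {P : V → Prop} (h : LinkedIn G S x y)
    (hP : ∀ u v, u ∈ S → v ∈ S → P u → G.Adj u v → P v) (hx : P x) : P y := by
  obtain ⟨w, hw⟩ := h
  induction w with
  | nil => exact hx
  | cons hadj p ih =>
    simp only [Walk.support_cons, List.mem_cons, forall_eq_or_imp] at hw
    exact ih (hP _ _ hw.1 (hw.2 _ p.start_mem_support) hx hadj) hw.2

end LinkedIn

/-- Any two vertices of `S` are joined inside `S`. -/
def SetConn (G : SimpleGraph V) (S : Set V) : Prop := ∀ x ∈ S, ∀ y ∈ S, LinkedIn G S x y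

theorem SetConn.of_base {S : Set V} (b : V) (h : ∀ x ∈ S, LinkedIn G S b x) : SetConn G S :=
  fun x hx y hy => (h x hx).symm.trans (h y hy)

theorem SetConn.induce_connected {S : Set V} (h : SetConn G S) (hS : S.Nonempty) :
    (G.induce S).Connected := by
  have : Nonempty S := hS.to_subtype
  refine ⟨fun x y => ?_⟩
  obtain ⟨w, hw⟩ := h x x.2 y y.2
  exact ⟨w.induce S hw⟩

/-- The vertices joined to `x` inside `S`. -/
def compIn (G : SimpleGraph V) (S : Set V) (x : V) : Set V := {y | LinkedIn G S x y}

theorem compIn_subset {S : Set V} {x : V} : compIn G S x ⊆ S := fun _ h => h.right_mem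

theorem mem_compIn_self {S : Set V} {x : V} (hx : x ∈ S) : x ∈ compIn G S x := LinkedIn.refl hx

theorem mem_compIn_of_adj {S : Set V} {x y z : V} (hy : y ∈ compIn G S x) (h : G.Adj y z)
    (hz : z ∈ S) : z ∈ compIn G S x := LinkedIn.snoc hy h hz

/-- Walks inside `S` do not leave the component of their start. -/
theorem LinkedIn.in_compIn {S : Set V} {x y : V} (h : LinkedIn G S x y) :
    LinkedIn G (compIn G S x) x y := by
  refine h.induct (P := fun y => LinkedIn G (compIn G S x) x y) ?_
    (LinkedIn.refl (mem_compIn_self h.left_mem))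
  intro u v _ hv hu huv
  exact hu.snoc huv (mem_compIn_of_adj hu.right_mem huv hv)

theorem setConn_compIn {S : Set V} {x : V} : SetConn G (compIn G S x) :=
  SetConn.of_base x fun _ hy => LinkedIn.in_compIn hy

theorem compIn_eq_of_mem {S : Set V} {x y : V} (h : y ∈ compIn G S x) :
    compIn G S y = compIn G S x := by
  ext z
  exact ⟨fun hz => LinkedIn.trans h hz, fun hz => (LinkedIn.symm h).trans hz⟩

/-- Some edge of `G` joins `A` and `B`. -/
def Touch (G : SimpleGraph V) (A B : Set V) : Prop := ∃ a ∈ A, ∃ b ∈ B, G.Adj a b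

theorem Touch.symm {A B : Set V} (h : Touch G A B) : Touch G B A := by
  obtain ⟨a, ha, b, hb, hab⟩ := h
  exact ⟨b, hb, a, ha, hab.symm⟩

theorem Touch.mono {A B A' B' : Set V} (h : Touch G A B) (hA : A ⊆ A') (hB : B ⊆ B') :
    Touch G A' B' := by
  obtain ⟨a, ha, b, hb, hab⟩ := h
  exact ⟨a, hA ha, b, hB hb, hab⟩

/-- If a walk in `T` runs from `A` to `A'` and all its vertices in `D` lie in `A ∪ A'`, then
`A` and `A'` are either adjacent or joined through `T \ D`. -/
theorem LinkedIn.excursion {T D A A' : Set V} {x y : V} (h : LinkedIn G T x y)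
    (hx : x ∈ A) (hy : y ∈ A') (hA' : A' ⊆ D) (hAA' : Disjoint A A')
    (hTD : ∀ z ∈ T, z ∈ D → z ∈ A ∨ z ∈ A') :
    (∃ a ∈ A ∩ T, ∃ a' ∈ A' ∩ T, G.Adj a a') ∨
      ∃ R, R.Nonempty ∧ SetConn G R ∧ R ⊆ T \ D ∧ Touch G R (A ∩ T) ∧ Touch G R (A' ∩ T) := by
  by_contra hcon
  push Not at hcon
  obtain ⟨h1, h2⟩ := hcon
  have key : y ∈ A ∨ (y ∉ D ∧ ∃ u, LinkedIn G (T \ D) u y ∧ ∃ a ∈ A ∩ T, G.Adj u a) := by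
    refine h.induct (P := fun y => y ∈ A ∨
      (y ∉ D ∧ ∃ u, LinkedIn G (T \ D) u y ∧ ∃ a ∈ A ∩ T, G.Adj u a)) ?_ (Or.inl hx)
    rintro u v hu hv (huA | ⟨huD, b, hb, a, ha, hba⟩) huv
    · by_cases hvD : v ∈ D
      · rcases hTD v hv hvD with h3 | h3
        · exact Or.inl h3
        · exact absurd huv (h1 u ⟨huA, hu⟩ v ⟨h3, hv⟩)
      · exact Or.inr ⟨hvD, v, LinkedIn.refl ⟨hv, hvD⟩, u, ⟨huA, hu⟩, huv.symm⟩
    · by_cases hvD : v ∈ D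
      · rcases hTD v hv hvD with h3 | h3
        · exact Or.inl h3
        · refine absurd ⟨u, ?_, v, ⟨h3, hv⟩, huv⟩
            (h2 (compIn G (T \ D) b) ⟨b, mem_compIn_self hb.left_mem⟩ setConn_compIn
              compIn_subset ⟨b, mem_compIn_self hb.left_mem, a, ha, hba⟩)
          exact hb
      · exact Or.inr ⟨hvD, b, hb.snoc huv ⟨hv, hvD⟩, a, ha, hba⟩
  rcases key with h3 | h3
  · exact Set.disjoint_left.1 hAA' h3 hy
  · exact h3.1 (hA' hy)

end Joined

section Minors

variable {V : Type} {G : SimpleGraph V}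

theorem isMinor_completeBipartite_of_sets {L R : Fin 3 → Set V}
    (hL : ∀ i, (L i).Nonempty ∧ SetConn G (L i)) (hR : ∀ i, (R i).Nonempty ∧ SetConn G (R i))
    (hLL : ∀ i j, i < j → Disjoint (L i) (L j)) (hRR : ∀ i j, i < j → Disjoint (R i) (R j))
    (hLR : ∀ i j, Disjoint (L i) (R j)) (hadj : ∀ i j, Touch G (L i) (R j)) :
    IsMinor (completeBipartiteGraph (Fin 3) (Fin 3)) G := by
  refine ⟨Sum.elim L R, ?_, ?_, ?_, ?_⟩
  · rintro (i | i)
    exacts [(hL i).1, (hR i).1]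
  · rintro (i | i)
    exacts [(hL i).2.induce_connected (hL i).1, (hR i).2.induce_connected (hR i).1]
  · rintro (i | i) (j | j) hij
    · rcases lt_or_gt_of_ne (fun h => hij (congrArg Sum.inl h) : i ≠ j) with h | h
      exacts [hLL i j h, (hLL j i h).symm]
    · exact hLR i j
    · exact (hLR j i).symm
    · rcases lt_or_gt_of_ne (fun h => hij (congrArg Sum.inr h) : i ≠ j) with h | h
      exacts [hRR i j h, (hRR j i h).symm]
  · rintro (i | i) (j | j) hij
    · simp at hij
    · exact hadj i j
    · exact (hadj j i).symm
    · simp at hij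

theorem isMinor_completeGraph_of_sets {n : ℕ} {B : Fin n → Set V}
    (hB : ∀ i, (B i).Nonempty ∧ SetConn G (B i))
    (hBB : ∀ i j, i < j → Disjoint (B i) (B j)) (hadj : ∀ i j, i < j → Touch G (B i) (B j)) :
    IsMinor (completeGraph (Fin n)) G := by
  refine ⟨B, fun i => (hB i).1, fun i => (hB i).2.induce_connected (hB i).1, ?_, ?_⟩
  · intro i j hij
    rcases lt_or_gt_of_ne hij with h | h
    exacts [hBB i j h, (hBB j i h).symm]
  · intro i j hij
    rcases lt_or_gt_of_ne (show i ≠ j from hij) with h | h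
    exacts [hadj i j h, (hadj j i h).symm]

theorem IsMinor.of_induce {W : Type} {H : SimpleGraph W} {s : Set V}
    (h : IsMinor H (G.induce s)) : IsMinor H G := by
  obtain ⟨B, h1, h2, h3, h4⟩ := h
  refine ⟨fun w => Subtype.val '' B w, fun w => (h1 w).image _, fun w => ?_, ?_, ?_⟩
  · refine (h2 w).map ⟨fun x => ⟨x.1.1, x.1, x.2, rfl⟩, fun h => h⟩ ?_
    rintro ⟨_, x, hx, rfl⟩
    exact ⟨⟨x, hx⟩, rfl⟩
  · intro a b hab
    exact (Set.disjoint_image_iff Subtype.val_injective).2 (h3 hab)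
  · intro a b hab
    obtain ⟨x, hx, y, hy, hxy⟩ := h4 a b hab
    exact ⟨x, ⟨x, hx, rfl⟩, y, ⟨y, hy, rfl⟩, hxy⟩

end Minors

section Cycles

variable {V : Type} {G : SimpleGraph V}

/-- The `m`-periodic sequence `c` runs around a cycle of length `m` in `G`. -/
structure IsCyc (G : SimpleGraph V) (m : ℕ) (c : ℕ → V) : Prop where
  three_le : 3 ≤ m
  periodic : ∀ i, c (i + m) = c i
  adj : ∀ i, G.Adj (c i) (c (i + 1))
  inj : ∀ i j, i < m → j < m → c i = c j → i = j

namespace IsCyc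

variable {m : ℕ} {c : ℕ → V}

theorem map_mod (h : IsCyc G m c) (i : ℕ) : c (i % m) = c i :=
  (show Function.Periodic c m from h.periodic).map_mod_nat i

theorem eq_iff (h : IsCyc G m c) {i j : ℕ} : c i = c j ↔ i % m = j % m := by
  have hm : 0 < m := by have := h.three_le; omega
  constructor
  · intro hij
    rw [← h.map_mod i, ← h.map_mod j] at hij
    exact h.inj _ _ (Nat.mod_lt _ hm) (Nat.mod_lt _ hm) hij
  · intro hij
    rw [← h.map_mod i, ← h.map_mod j, hij]

theorem ne_of_lt (h : IsCyc G m c) {i j : ℕ} (hij : i < j) (hj : j < i + m) : c i ≠ c j := by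
  rw [Ne, h.eq_iff]
  intro he
  have h1 : (j - i) % m = 0 := Nat.sub_mod_eq_zero_of_mod_eq he.symm
  rw [Nat.mod_eq_of_lt (by omega)] at h1
  omega

theorem eq_of_window (h : IsCyc G m c) {i j k : ℕ} (hi : k ≤ i) (hi' : i < k + m) (hj : k ≤ j)
    (hj' : j < k + m) (he : c i = c j) : i = j := by
  rcases lt_trichotomy i j with hlt | heq | hlt
  · exact absurd he (h.ne_of_lt hlt (by omega))
  · exact heq
  · exact absurd he.symm (h.ne_of_lt hlt (by omega))

theorem shift (h : IsCyc G m c) (k : ℕ) : IsCyc G m (fun i => c (i + k)) where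
  three_le := h.three_le
  periodic i := by rw [add_right_comm, h.periodic]
  adj i := by rw [add_right_comm]; exact h.adj _
  inj i j hi hj hij := by
    have := h.eq_of_window (k := k) (by omega) (by omega) (by omega) (by omega) hij
    omega

theorem exists_window (h : IsCyc G m c) {x : V} (hx : x ∈ Set.range c) (k : ℕ) :
    ∃ i, k ≤ i ∧ i < k + m ∧ c i = x := by
  obtain ⟨l, rfl⟩ := hx
  have hm : 0 < m := by have := h.three_le; omega
  have h1 := Nat.mod_lt (l + k * m - k) hm
  refine ⟨k + (l + k * m - k) % m, by omega, by omega, ?_⟩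
  rw [h.eq_iff, Nat.add_mod_mod]
  have h2 : k ≤ l + k * m := (Nat.le_mul_of_pos_right k hm).trans (Nat.le_add_left _ _)
  rw [show k + (l + k * m - k) = l + k * m by omega]
  simp

theorem range_eq_image (h : IsCyc G m c) (k : ℕ) : Set.range c = c '' Set.Ico k (k + m) := by
  ext x
  constructor
  · intro hx
    obtain ⟨i, h1, h2, h3⟩ := h.exists_window hx k
    exact ⟨i, ⟨h1, h2⟩, h3⟩
  · rintro ⟨i, _, rfl⟩
    exact ⟨i, rfl⟩

theorem range_shift (h : IsCyc G m c) (k : ℕ) : Set.range (fun i => c (i + k)) = Set.range c := by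
  ext x
  constructor
  · rintro ⟨i, rfl⟩
    exact ⟨i + k, rfl⟩
  · intro hx
    obtain ⟨i, h1, _, h3⟩ := h.exists_window hx k
    exact ⟨i - k, by simpa [Nat.sub_add_cancel h1] using h3⟩

theorem linkedIn_arc (h : IsCyc G m c) {i j : ℕ} (hij : i ≤ j) :
    LinkedIn G (c '' Set.Icc i j) (c i) (c j) := by
  induction j, hij using Nat.le_induction with
  | base => exact LinkedIn.refl ⟨i, by simp, rfl⟩
  | succ j hij ih =>
    refine (ih.mono (Set.image_mono (Set.Icc_subset_Icc_right (by omega)))).snoc (h.adj j) ?_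
    exact ⟨j + 1, ⟨by omega, le_rfl⟩, rfl⟩

theorem setConn_arc (h : IsCyc G m c) (i j : ℕ) : SetConn G (c '' Set.Ico i j) := by
  refine SetConn.of_base (c i) ?_
  rintro _ ⟨l, ⟨h1, h2⟩, rfl⟩
  refine (h.linkedIn_arc h1).mono (Set.image_mono fun x hx => ?_)
  exact ⟨hx.1, hx.2.trans_lt h2⟩

theorem disjoint_arc (h : IsCyc G m c) {i j k l : ℕ} (hjk : j ≤ k) (hl : l ≤ i + m) :
    Disjoint (c '' Set.Ico i j) (c '' Set.Ico k l) := by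
  rw [Set.disjoint_left]
  rintro _ ⟨a, ⟨h1, h2⟩, rfl⟩ ⟨b, ⟨h3, h4⟩, hb⟩
  exact h.ne_of_lt (i := a) (j := b) (by omega) (by omega) hb.symm

theorem touch_arc (h : IsCyc G m c) {i j k : ℕ} (hij : i < j) (hjk : j < k) :
    Touch G (c '' Set.Ico i j) (c '' Set.Ico j k) :=
  ⟨c (j - 1), ⟨j - 1, ⟨by omega, by omega⟩, rfl⟩, c j, ⟨j, ⟨le_rfl, hjk⟩, rfl⟩, by
    have := h.adj (j - 1)
    rwa [Nat.sub_add_cancel (by omega)] at this⟩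

theorem touch_arc_wrap (h : IsCyc G m c) {i j k : ℕ} (hij : i < j) (hjk : k < i + m) :
    Touch G (c '' Set.Ico k (i + m)) (c '' Set.Ico i j) :=
  ⟨c (i + m - 1), ⟨i + m - 1, ⟨by omega, by omega⟩, rfl⟩, c i, ⟨i, ⟨le_rfl, hij⟩, rfl⟩, by
    have := h.adj (i + m - 1)
    rwa [Nat.sub_add_cancel (by omega), h.periodic] at this⟩

/-- Every vertex of a cycle has two distinct neighbors on it. -/
theorem exists_two_neighbors (h : IsCyc G m c) {x : V} (hx : x ∈ Set.range c) :
    ∃ y ∈ Set.range c, ∃ z ∈ Set.range c, y ≠ z ∧ G.Adj x y ∧ G.Adj x z := by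
  obtain ⟨i, h1, h2, rfl⟩ := h.exists_window hx 1
  have := h.three_le
  refine ⟨c (i - 1), ⟨_, rfl⟩, c (i + 1), ⟨_, rfl⟩, h.ne_of_lt (by omega) (by omega), ?_, h.adj i⟩
  have := h.adj (i - 1)
  rw [Nat.sub_add_cancel h1] at this
  exact this.symm

theorem edge_inj (h : IsCyc G m c) {i j : ℕ} (hi : i < m) (hj : j < m)
    (he : s(c i, c (i + 1)) = s(c j, c (j + 1))) : i = j := by
  have := h.three_le
  rw [Sym2.eq_iff] at he
  rcases he with ⟨h1, _⟩ | ⟨h1, h2⟩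
  · exact h.inj i j hi hj h1
  · exfalso
    rcases lt_or_ge i j with hlt | hge
    · by_cases hl : j + 1 = i + m
      · exact h.ne_of_lt (i := i + 1) (j := j) (by omega) (by omega) h2
      · exact h.ne_of_lt (i := i) (j := j + 1) (by omega) (by omega) h1
    · by_cases hl : i = j + 1
      · exact h.ne_of_lt (i := j) (j := i + 1) (by omega) (by omega) h2.symm
      · by_cases hl2 : i = j
        · subst hl2
          exact h.ne_of_lt (i := i) (j := i + 1) (by omega) (by omega) h1
        · exact h.ne_of_lt (i := j + 1) (j := i) (by omega) (by omega) h1.symm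

/-- A periodic cyclic sequence gives a cycle in the sense of walks. -/
theorem exists_isCycle (h : IsCyc G m c) : ∃ a, ∃ w : G.Walk a a, w.IsCycle ∧ w.length = m := by
  have hm := h.three_le
  have key : ∀ j, j < m → ∃ w : G.Walk (c j) (c 0), w.support = (List.range (j + 1)).reverse.map c ∧
      w.length = j ∧ ∀ e ∈ w.edges, ∃ l, l < j ∧ e = s(c l, c (l + 1)) := by
    intro j
    induction j with
    | zero => intro _; exact ⟨.nil, by simp, rfl, by simp⟩
    | succ j ih =>
      intro hj
      obtain ⟨w, h1, h2, h3⟩ := ih (by omega)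
      refine ⟨.cons (h.adj j).symm w, ?_, by simp [h2], ?_⟩
      · rw [Walk.support_cons, h1, List.range_succ (n := j + 1), List.reverse_append]
        simp
      · intro e he
        rw [Walk.edges_cons, List.mem_cons] at he
        rcases he with rfl | he
        · exact ⟨j, by omega, Sym2.eq_swap⟩
        · obtain ⟨l, hl, rfl⟩ := h3 e he
          exact ⟨l, by omega, rfl⟩
  obtain ⟨w, h1, h2, h3⟩ := key (m - 1) (by omega)
  have hadj : G.Adj (c 0) (c (m - 1)) := by
    have := h.adj (m - 1)
    rw [Nat.sub_add_cancel (by omega), ← Nat.zero_add m, h.periodic] at this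
    simpa using this.symm
  refine ⟨_, .cons hadj w, ?_, by simp [h2]; omega⟩
  rw [Walk.cons_isCycle_iff]
  refine ⟨?_, ?_⟩
  · rw [Walk.isPath_def, h1]
    refine List.Nodup.map_on ?_ (by simp [List.nodup_range])
    intro i hi j hj hij
    simp only [List.mem_reverse, List.mem_range] at hi hj
    exact h.inj i j (by omega) (by omega) hij
  · intro he
    obtain ⟨l, hl, hle⟩ := h3 _ he
    have h4 : s(c 0, c (m - 1)) = s(c (m - 1), c (m - 1 + 1)) := by
      rw [Nat.sub_add_cancel (by omega : 1 ≤ m), Sym2.eq_swap, ← h.periodic 0]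
      simp
    have := h.edge_inj (by omega) (by omega) (h4.symm.trans hle)
    omega

end IsCyc

/-- An induced cycle whose complement is connected. -/
structure IsPeripheral (G : SimpleGraph V) (m : ℕ) (c : ℕ → V) : Prop extends IsCyc G m c where
  chordless : ∀ i j, G.Adj (c i) (c j) → c j = c (i + 1) ∨ c i = c (j + 1)
  compl : SetConn G (Set.range c)ᶜ

namespace IsPeripheral

variable {m : ℕ} {c : ℕ → V}

theorem shift (h : IsPeripheral G m c) (k : ℕ) : IsPeripheral G m (fun i => c (i + k)) where
  toIsCyc := h.toIsCyc.shift k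
  chordless i j hij := by
    rcases h.chordless _ _ hij with h1 | h1
    · left; rw [h1]; congr 1; omega
    · right; rw [h1]; congr 1; omega
  compl := by rw [h.toIsCyc.range_shift]; exact h.compl

theorem adj_eq (h : IsPeripheral G m c) {i : ℕ} {x : V} (hi : 0 < i) (hx : x ∈ Set.range c)
    (hadj : G.Adj (c i) x) : x = c (i - 1) ∨ x = c (i + 1) := by
  obtain ⟨j, rfl⟩ := hx
  rcases h.chordless _ _ hadj with h1 | h1
  · exact Or.inr h1
  · left
    rw [h.toIsCyc.eq_iff] at h1 ⊢
    have h2 : (j + 1) ≡ (i - 1 + 1) [MOD m] := by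
      rw [Nat.sub_add_cancel hi]; exact h1.symm
    exact Nat.ModEq.add_right_cancel' 1 h2

/-- A vertex of an induced cycle has only two neighbors on it. -/
theorem eq_or_eq_of_adj (h : IsPeripheral G m c) {x y z u : V} (hx : x ∈ Set.range c)
    (hy : y ∈ Set.range c) (hz : z ∈ Set.range c) (hu : u ∈ Set.range c) (hyz : y ≠ z)
    (hxy : G.Adj x y) (hxz : G.Adj x z) (hxu : G.Adj x u) : u = y ∨ u = z := by
  obtain ⟨i, hi, _, rfl⟩ := h.toIsCyc.exists_window hx 1
  rcases h.adj_eq hi hy hxy with rfl | rfl <;> rcases h.adj_eq hi hz hxz with rfl | rfl <;>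
    rcases h.adj_eq hi hu hxu with rfl | rfl <;> simp_all

end IsPeripheral

end Cycles

section Overlap

variable {V : Type} {G : SimpleGraph V}

theorem Touch.nonempty {A B : Set V} (h : Touch G A B) : A.Nonempty := by
  obtain ⟨a, ha, _⟩ := h
  exact ⟨a, ha⟩

theorem isMinor_completeBipartite_three {A₀ A₁ A₂ B₀ B₁ B₂ : Set V}
    (hA : SetConn G A₀ ∧ SetConn G A₁ ∧ SetConn G A₂)
    (hB : SetConn G B₀ ∧ SetConn G B₁ ∧ SetConn G B₂)
    (hAA : Disjoint A₀ A₁ ∧ Disjoint A₀ A₂ ∧ Disjoint A₁ A₂)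
    (hBB : Disjoint B₀ B₁ ∧ Disjoint B₀ B₂ ∧ Disjoint B₁ B₂)
    (h₀ : Disjoint A₀ B₀ ∧ Disjoint A₀ B₁ ∧ Disjoint A₀ B₂)
    (h₁ : Disjoint A₁ B₀ ∧ Disjoint A₁ B₁ ∧ Disjoint A₁ B₂)
    (h₂ : Disjoint A₂ B₀ ∧ Disjoint A₂ B₁ ∧ Disjoint A₂ B₂)
    (t₀ : Touch G A₀ B₀ ∧ Touch G A₀ B₁ ∧ Touch G A₀ B₂)
    (t₁ : Touch G A₁ B₀ ∧ Touch G A₁ B₁ ∧ Touch G A₁ B₂)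
    (t₂ : Touch G A₂ B₀ ∧ Touch G A₂ B₁ ∧ Touch G A₂ B₂) :
    IsMinor (completeBipartiteGraph (Fin 3) (Fin 3)) G := by
  refine isMinor_completeBipartite_of_sets (L := ![A₀, A₁, A₂]) (R := ![B₀, B₁, B₂])
    ?_ ?_ ?_ ?_ ?_ ?_
  · simpa [Fin.forall_fin_succ] using
      ⟨⟨t₀.1.nonempty, hA.1⟩, ⟨t₁.1.nonempty, hA.2.1⟩, t₂.1.nonempty, hA.2.2⟩
  · simpa [Fin.forall_fin_succ] using
      ⟨⟨t₀.1.symm.nonempty, hB.1⟩, ⟨t₀.2.1.symm.nonempty, hB.2.1⟩,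
        t₀.2.2.symm.nonempty, hB.2.2⟩
  · intro i j hij
    fin_cases i <;> fin_cases j <;> first | exact absurd hij (by decide) | skip
    exacts [hAA.1, hAA.2.1, hAA.2.2]
  · intro i j hij
    fin_cases i <;> fin_cases j <;> first | exact absurd hij (by decide) | skip
    exacts [hBB.1, hBB.2.1, hBB.2.2]
  · simpa [Fin.forall_fin_succ] using ⟨h₀, h₁, h₂⟩
  · simpa [Fin.forall_fin_succ] using ⟨t₀, t₁, t₂⟩

theorem isMinor_completeGraph_five {A₀ A₁ A₂ A₃ A₄ : Set V}
    (hA : SetConn G A₀ ∧ SetConn G A₁ ∧ SetConn G A₂ ∧ SetConn G A₃ ∧ SetConn G A₄)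
    (h₀ : Disjoint A₀ A₁ ∧ Disjoint A₀ A₂ ∧ Disjoint A₀ A₃ ∧ Disjoint A₀ A₄)
    (h₁ : Disjoint A₁ A₂ ∧ Disjoint A₁ A₃ ∧ Disjoint A₁ A₄)
    (h₂ : Disjoint A₂ A₃ ∧ Disjoint A₂ A₄) (h₃ : Disjoint A₃ A₄)
    (t₀ : Touch G A₀ A₁ ∧ Touch G A₀ A₂ ∧ Touch G A₀ A₃ ∧ Touch G A₀ A₄)
    (t₁ : Touch G A₁ A₂ ∧ Touch G A₁ A₃ ∧ Touch G A₁ A₄)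
    (t₂ : Touch G A₂ A₃ ∧ Touch G A₂ A₄) (t₃ : Touch G A₃ A₄) :
    IsMinor (completeGraph (Fin 5)) G := by
  refine isMinor_completeGraph_of_sets (B := ![A₀, A₁, A₂, A₃, A₄]) ?_ ?_ ?_
  · simpa [Fin.forall_fin_succ] using
      ⟨⟨t₀.1.nonempty, hA.1⟩, ⟨t₁.1.nonempty, hA.2.1⟩, ⟨t₂.1.nonempty, hA.2.2.1⟩,
        ⟨t₃.nonempty, hA.2.2.2.1⟩, t₃.symm.nonempty, hA.2.2.2.2⟩
  · intro i j hij
    fin_cases i <;> fin_cases j <;> first | exact absurd hij (by decide) | skip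
    exacts [h₀.1, h₀.2.1, h₀.2.2.1, h₀.2.2.2, h₁.1, h₁.2.1, h₁.2.2, h₂.1, h₂.2, h₃]
  · intro i j hij
    fin_cases i <;> fin_cases j <;> first | exact absurd hij (by decide) | skip
    exacts [t₀.1, t₀.2.1, t₀.2.2.1, t₀.2.2.2, t₁.1, t₁.2.1, t₁.2.2, t₂.1, t₂.2, t₃]

/-- If `x ∉ B` is joined inside `T` to a point of `B`, then the component of `x` in `T \ B` touches
`B`. -/
theorem LinkedIn.touch_compIn {T B : Set V} {x y : V} (h : LinkedIn G T x y) (hx : x ∉ B)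
    (hy : y ∈ B) : Touch G (compIn G (T \ B) x) B := by
  by_contra hcon
  have : y ∈ compIn G (T \ B) x := by
    refine h.induct (P := fun y => y ∈ compIn G (T \ B) x) ?_ (mem_compIn_self ⟨h.left_mem, hx⟩)
    intro u v _ hv hu huv
    exact mem_compIn_of_adj hu huv ⟨hv, fun hvB => hcon ⟨u, hu, v, hvB, huv⟩⟩
  exact (compIn_subset this).2 hy

/-- Two disjoint connected sets attached alternately to a cycle with connected complement. -/
theorem IsCyc.isMinor_of_cross {m : ℕ} {c : ℕ → V} (h : IsCyc G m c)
    (hcompl : SetConn G (Set.range c)ᶜ) {x₀ x₁ x₂ x₃ : ℕ} (h₀₁ : x₀ < x₁) (h₁₂ : x₁ < x₂)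
    (h₂₃ : x₂ < x₃) (h₃ : x₃ < x₀ + m) {R S : Set V} (hR : SetConn G R) (hS : SetConn G S)
    (hRc : R ⊆ (Set.range c)ᶜ) (hSc : S ⊆ (Set.range c)ᶜ) (hRS : Disjoint R S)
    (t₀ : Touch G R {c x₀}) (t₂ : Touch G R {c x₂}) (t₁ : Touch G S {c x₁})
    (t₃ : Touch G S {c x₃}) : IsMinor (completeBipartiteGraph (Fin 3) (Fin 3)) G := by
  obtain ⟨r, hr⟩ := t₀.nonempty
  obtain ⟨s, hs⟩ := t₁.nonempty
  set R' := compIn G ((Set.range c)ᶜ \ S) r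
  have hRR' : R ⊆ R' := fun y hy => (hR r hr y hy).mono fun z hz =>
    ⟨hRc hz, Set.disjoint_left.1 hRS hz⟩
  have hR'c : R' ⊆ (Set.range c)ᶜ \ S := compIn_subset
  have hR'S : Touch G R' S :=
    (hcompl r (hRc hr) s (hSc hs)).touch_compIn (Set.disjoint_left.1 hRS hr) hs
  have harc : ∀ {A : Set V} (i j : ℕ), A ⊆ (Set.range c)ᶜ → Disjoint A (c '' Set.Ico i j) := by
    intro A i j hA
    refine Set.disjoint_left.2 fun y hy hy' => hA hy ?_
    obtain ⟨l, _, rfl⟩ := hy'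
    exact ⟨l, rfl⟩
  have hR'c' : R' ⊆ (Set.range c)ᶜ := fun y hy => (hR'c hy).1
  have hsing : ∀ {i j : ℕ}, i < j → ({c i} : Set V) ⊆ c '' Set.Ico i j := fun {i j} hij =>
    Set.singleton_subset_iff.2 ⟨i, ⟨le_rfl, hij⟩, rfl⟩
  refine isMinor_completeBipartite_three (A₀ := R') (A₁ := c '' Set.Ico x₁ x₂)
    (A₂ := c '' Set.Ico x₃ (x₀ + m)) (B₀ := S) (B₁ := c '' Set.Ico x₀ x₁)
    (B₂ := c '' Set.Ico x₂ x₃) ⟨setConn_compIn, h.setConn_arc _ _, h.setConn_arc _ _⟩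
    ⟨hS, h.setConn_arc _ _, h.setConn_arc _ _⟩
    ⟨harc _ _ hR'c', harc _ _ hR'c', h.disjoint_arc h₂₃.le (by omega)⟩
    ⟨harc _ _ hSc, harc _ _ hSc, h.disjoint_arc h₁₂.le (by omega)⟩
    ⟨Set.disjoint_left.2 fun y hy => (hR'c hy).2, harc _ _ hR'c', harc _ _ hR'c'⟩
    ⟨(harc _ _ hSc).symm, (h.disjoint_arc le_rfl (by omega)).symm,
      h.disjoint_arc le_rfl (by omega)⟩
    ⟨(harc _ _ hSc).symm, (h.disjoint_arc (by omega) (by omega)).symm,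
      (h.disjoint_arc le_rfl (by omega)).symm⟩
    ⟨hR'S, t₀.mono hRR' (hsing h₀₁), t₂.mono hRR' (hsing h₂₃)⟩
    ⟨(t₁.mono subset_rfl (hsing h₁₂)).symm, (h.touch_arc h₀₁ h₁₂).symm, h.touch_arc h₁₂ h₂₃⟩
    ⟨(t₃.mono subset_rfl (hsing h₃)).symm, h.touch_arc_wrap h₀₁ h₃,
      (h.touch_arc h₂₃ h₃).symm⟩

namespace IsPeripheral

variable {m : ℕ} {c : ℕ → V}

/-- A walk between the two sides of a peripheral cycle runs through its complement. -/
theorem exists_bridge (h : IsPeripheral G m c) {T : Set V} {p i q k : ℕ} (hpi : p < i)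
    (hiq : i < q) (hqk : q < k) (hk : k < p + m) (hT : LinkedIn G T (c i) (c k))
    (hp : c p ∉ T) (hq : c q ∉ T) :
    ∃ a b R, p < a ∧ a < q ∧ q < b ∧ b < p + m ∧ c a ∈ T ∧ c b ∈ T ∧ SetConn G R ∧
      R ⊆ T ∧ R ⊆ (Set.range c)ᶜ ∧ Touch G R {c a} ∧ Touch G R {c b} := by
  have key := hT.excursion (D := Set.range c) (A := c '' Set.Ico p q)
    (A' := c '' Set.Ico q (p + m)) ⟨i, ⟨hpi.le, hiq⟩, rfl⟩ ⟨k, ⟨hqk.le, hk⟩, rfl⟩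
    (by rintro _ ⟨l, _, rfl⟩; exact ⟨l, rfl⟩) (h.toIsCyc.disjoint_arc le_rfl le_rfl) (by
      intro z _ hz
      obtain ⟨l, h1, h2, rfl⟩ := h.toIsCyc.exists_window hz p
      rcases lt_or_ge l q with h3 | h3
      exacts [Or.inl ⟨l, ⟨h1, h3⟩, rfl⟩, Or.inr ⟨l, ⟨h3, h2⟩, rfl⟩])
  have hA : ∀ x ∈ c '' Set.Ico p q ∩ T, ∃ a, p < a ∧ a < q ∧ c a = x := by
    rintro _ ⟨⟨a, ⟨h1, h2⟩, rfl⟩, haT⟩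
    exact ⟨a, lt_of_le_of_ne h1 fun he => hp (he ▸ haT), h2, rfl⟩
  have hB : ∀ x ∈ c '' Set.Ico q (p + m) ∩ T, ∃ a, q < a ∧ a < p + m ∧ c a = x := by
    rintro _ ⟨⟨a, ⟨h1, h2⟩, rfl⟩, haT⟩
    exact ⟨a, lt_of_le_of_ne h1 fun he => hq (he ▸ haT), h2, rfl⟩
  rcases key with ⟨x, hx, y, hy, hxy⟩ | ⟨R, _, hR, hRT, ⟨u, hu, x, hx, hux⟩, v, hv, y, hy, hvy⟩
  · exfalso
    obtain ⟨a, h1, h2, rfl⟩ := hA x hx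
    obtain ⟨b, h3, h4, rfl⟩ := hB y hy
    rcases h.chordless _ _ hxy with he | he
    · have := h.toIsCyc.eq_of_window (k := p) (by omega) (by omega) (by omega) (by omega) he
      omega
    · have := h.toIsCyc.eq_of_window (k := p + 1) (by omega) (by omega) (by omega) (by omega) he
      omega
  · obtain ⟨a, h1, h2, rfl⟩ := hA x hx
    obtain ⟨b, h3, h4, rfl⟩ := hB y hy
    exact ⟨a, b, R, h1, h2, h3, h4, hx.2, hy.2, hR, fun z hz => (hRT hz).1,
      fun z hz => (hRT hz).2, ⟨u, hu, _, rfl, hux⟩, v, hv, _, rfl, hvy⟩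

/-- Disjoint connections between alternating vertices of a peripheral cycle. -/
theorem isMinor_of_alternating (h : IsPeripheral G m c) {T₁ T₂ : Set V} {i j k : ℕ}
    (hi : 0 < i) (hij : i < j) (hjk : j < k) (hk : k < m) (h₁ : LinkedIn G T₁ (c i) (c k))
    (h₂ : LinkedIn G T₂ (c 0) (c j)) (hT : Disjoint T₁ T₂) :
    IsMinor (completeBipartiteGraph (Fin 3) (Fin 3)) G := by
  obtain ⟨a, b, R, a1, a2, b1, b2, haT, hbT, hR, hRT, hRc, ta, tb⟩ :=
    h.exists_bridge (p := 0) hi hij hjk (by omega) h₁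
      (fun h3 => Set.disjoint_left.1 hT h3 h₂.left_mem)
      (fun h3 => Set.disjoint_left.1 hT h3 h₂.right_mem)
  have h0 : c 0 = c m := by simpa using (h.toIsCyc.periodic 0).symm
  obtain ⟨a', b', S, a1', a2', b1', b2', _, _, hS, hST, hSc, ta', tb'⟩ :=
    h.exists_bridge (p := a) (q := b) (k := m) a2 b1 (by omega) (by omega) (h0 ▸ h₂.symm)
      (fun h3 => Set.disjoint_left.1 hT haT h3) (fun h3 => Set.disjoint_left.1 hT hbT h3)
  exact h.toIsCyc.isMinor_of_cross h.compl a1' a2' b1' b2' hR hS hRc hSc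
    (hT.mono hRT hST) ta tb ta' tb'

end IsPeripheral

theorem IsCyc.setConn_range {m : ℕ} {c : ℕ → V} (h : IsCyc G m c) :
    SetConn G (Set.range c) := by
  rw [h.range_eq_image 0]
  exact h.setConn_arc _ _

/-- A peripheral cycle meets another one in an arc. -/
theorem IsPeripheral.exists_overlap {m n : ℕ} {c d : ℕ → V} (h : IsPeripheral G m c)
    (h' : IsPeripheral G n d) (hK : ¬ IsMinor (completeBipartiteGraph (Fin 3) (Fin 3)) G)
    (hcd : ¬ Set.range c ⊆ Set.range d) (hne : (Set.range c ∩ Set.range d).Nonempty) :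
    ∃ k l, l + 1 < m ∧ ∀ i < m, (c (i + k) ∈ Set.range d ↔ i ≤ l) := by
  classical
  obtain ⟨u, hu, hu'⟩ : ∃ u, c u ∉ Set.range d ∧ c (u + 1) ∈ Set.range d := by
    by_contra! hcon
    rw [Set.not_subset] at hcd
    obtain ⟨_, ⟨i, rfl⟩, hi⟩ := hcd
    obtain ⟨_, hx, hxd⟩ := hne
    obtain ⟨j, hj, _, rfl⟩ := h.toIsCyc.exists_window hx i
    exact Nat.le_induction (P := fun j _ => c j ∉ Set.range d) hi (fun j _ => hcon j) j hj hxd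
  have hs := h.shift (u + 1)
  have hm := h.three_le
  have hlast : c (m - 1 + (u + 1)) ∉ Set.range d := by
    rw [show m - 1 + (u + 1) = u + m by omega, h.periodic]
    exact hu
  have hex : ∃ l, c (l + (u + 1)) ∉ Set.range d := ⟨_, hlast⟩
  have hN : c (Nat.find hex + (u + 1)) ∉ Set.range d := Nat.find_spec hex
  have hmin : ∀ l < Nat.find hex, c (l + (u + 1)) ∈ Set.range d := fun l hl =>
    not_not.1 (Nat.find_min hex hl)
  have hle : Nat.find hex ≤ m - 1 := Nat.find_min' hex hlast
  have hpos : Nat.find hex ≠ 0 := by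
    intro h0
    rw [h0, zero_add] at hN
    exact hN hu'
  refine ⟨u + 1, Nat.find hex - 1, by omega, fun i hi => ⟨fun hid => ?_, fun hil => ?_⟩⟩
  · by_contra hlt
    have h1 : i ≠ Nat.find hex := fun he => hN (he ▸ hid)
    have h2 : i ≠ m - 1 := fun he => hlast (he ▸ hid)
    refine hK (hs.isMinor_of_alternating (T₁ := (Set.range d)ᶜ) (T₂ := Set.range d)
      (i := Nat.find hex) (j := i) (k := m - 1) (by omega) (by omega) (by omega) (by omega)
      (h'.compl _ hN _ hlast) (h'.toIsCyc.setConn_range _ ?_ _ hid) disjoint_compl_left)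
    simpa using hu'
  · exact hmin i (by omega)

/-- The vertex sets of peripheral cycles are incomparable. -/
theorem IsPeripheral.range_subset_of_subset {m n : ℕ} {c d : ℕ → V} (h : IsPeripheral G m c)
    (h' : IsCyc G n d) (hdc : Set.range d ⊆ Set.range c) : Set.range c ⊆ Set.range d := by
  have step : ∀ i, 0 < i → c i ∈ Set.range d → c (i + 1) ∈ Set.range d := by
    intro i hi hid
    obtain ⟨y, hy, z, hz, hyz, h1, h2⟩ := h'.exists_two_neighbors hid
    rcases h.adj_eq hi (hdc hy) h1 with rfl | rfl
    · rcases h.adj_eq hi (hdc hz) h2 with rfl | rfl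
      · exact absurd rfl hyz
      · exact hz
    · exact hy
  obtain ⟨i, hi, _, hid⟩ := h.toIsCyc.exists_window (hdc ⟨0, rfl⟩) 1
  have all : ∀ j, i ≤ j → c j ∈ Set.range d := fun j hj =>
    Nat.le_induction (P := fun j _ => c j ∈ Set.range d) (hid ▸ ⟨0, rfl⟩)
      (fun j hj => step j (by omega)) j hj
  intro x hx
  obtain ⟨j, hj, _, rfl⟩ := h.toIsCyc.exists_window hx i
  exact all j hj

/-- The difference of two intersecting peripheral cycles is connected. -/
theorem IsPeripheral.setConn_diff {m n : ℕ} {c d : ℕ → V} (h : IsPeripheral G m c)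
    (h' : IsPeripheral G n d) (hK : ¬ IsMinor (completeBipartiteGraph (Fin 3) (Fin 3)) G)
    (hcd : ¬ Set.range c ⊆ Set.range d) (hne : (Set.range c ∩ Set.range d).Nonempty) :
    SetConn G (Set.range c \ Set.range d) := by
  obtain ⟨k, l, hl, hkl⟩ := h.exists_overlap h' hK hcd hne
  have hs := (h.shift k).toIsCyc
  have : Set.range c \ Set.range d = (fun i => c (i + k)) '' Set.Ico (l + 1) m := by
    rw [← h.toIsCyc.range_shift k, hs.range_eq_image 0, zero_add]
    ext x
    constructor
    · rintro ⟨⟨i, hi, rfl⟩, hx⟩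
      refine ⟨i, ⟨?_, hi.2⟩, rfl⟩
      by_contra hcon
      exact hx ((hkl i hi.2).2 (by omega))
    · rintro ⟨i, hi, rfl⟩
      refine ⟨⟨i, ⟨Nat.zero_le _, hi.2⟩, rfl⟩, fun hx => ?_⟩
      have := (hkl i hi.2).1 hx
      have := hi.1
      omega
  rw [this]
  exact hs.setConn_arc _ _

end Overlap

section ThreeFaces

variable {V : Type} {G : SimpleGraph V}

/-- The ends of the common arc touch the rest of the second cycle. -/
theorem IsPeripheral.touch_diff_of_end {m n l : ℕ} {c d : ℕ → V} (h : IsPeripheral G m c)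
    (h' : IsPeripheral G n d) (hl : l + 1 < m) (hcd : ∀ i < m, (c i ∈ Set.range d ↔ i ≤ l))
    {i : ℕ} (hi : i = 0 ∨ i = l) : Touch G {c i} (Set.range d \ Set.range c) := by
  have hid : c i ∈ Set.range d := (hcd i (by omega)).2 (by omega)
  obtain ⟨y, hy, z, hz, hyz, h1, h2⟩ := h'.toIsCyc.exists_two_neighbors hid
  by_contra hcon
  have key : ∀ y ∈ Set.range d, G.Adj (c i) y → y ∈ Set.range c := by
    intro y hy h1
    by_contra hyc
    exact hcon ⟨_, rfl, y, ⟨hy, hyc⟩, h1⟩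
  have hone : ∀ y ∈ Set.range d, G.Adj (c i) y → y = c (if i = 0 then 1 else i - 1) := by
    intro y hy h1
    have h0 : c m = c 0 := by simpa using h.periodic 0
    rcases hi with rfl | rfl
    · rw [if_pos rfl]
      rw [← h0] at h1
      rcases h.adj_eq (by omega) (key y hy (h0 ▸ h1)) h1 with rfl | rfl
      · have := (hcd (m - 1) (by omega)).1 hy
        omega
      · rw [add_comm, h.periodic]
    · by_cases hi0 : i = 0
      · subst hi0
        rw [if_pos rfl]
        rw [← h0] at h1
        rcases h.adj_eq (by omega) (key y hy (h0 ▸ h1)) h1 with rfl | rfl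
        · have := (hcd (m - 1) (by omega)).1 hy
          omega
        · rw [add_comm, h.periodic]
      · rw [if_neg hi0]
        rcases h.adj_eq (by omega) (key y hy h1) h1 with rfl | rfl
        · rfl
        · have := (hcd (i + 1) (by omega)).1 hy
          omega
  exact hyz ((hone y hy h1).trans (hone z hz h2).symm)

theorem IsCyc.diff_eq_arc {m l : ℕ} {c : ℕ → V} (h : IsCyc G m c) {S : Set V}
    (hcd : ∀ i < m, (c i ∈ S ↔ i ≤ l)) :
    Set.range c \ S = c '' Set.Ico (l + 1) m := by
  rw [h.range_eq_image 0, zero_add]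
  ext x
  constructor
  · rintro ⟨⟨i, hi, rfl⟩, hx⟩
    refine ⟨i, ⟨?_, hi.2⟩, rfl⟩
    by_contra hcon
    exact hx ((hcd i hi.2).2 (by omega))
  · rintro ⟨i, hi, rfl⟩
    refine ⟨⟨i, ⟨Nat.zero_le _, hi.2⟩, rfl⟩, fun hx => ?_⟩
    have := (hcd i hi.2).1 hx
    have := hi.1
    omega

/-- Inner vertices of the common arc of two peripheral cycles have degree two. -/
theorem IsPeripheral.eq_of_adj_of_inner {m n l : ℕ} {c d : ℕ → V} (h : IsPeripheral G m c)
    (h' : IsPeripheral G n d) (hK : ¬ IsMinor (completeBipartiteGraph (Fin 3) (Fin 3)) G)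
    (hl : l + 1 < m) (hcd : ∀ i < m, (c i ∈ Set.range d ↔ i ≤ l)) {i : ℕ} (hi : 0 < i)
    (hil : i < l) {z : V} (hz : G.Adj (c i) z) : z = c (i - 1) ∨ z = c (i + 1) := by
  by_contra hcon
  have hprev : G.Adj (c i) (c (i - 1)) := by
    have := h.adj (i - 1)
    rw [Nat.sub_add_cancel hi] at this
    exact this.symm
  have hzc : z ∉ Set.range c := fun hzc => hcon (h.adj_eq hi hzc hz)
  have hmem : ∀ j, j ≤ l → c j ∈ Set.range d := fun j hj => (hcd j (by omega)).2 hj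
  have hzd : z ∉ Set.range d := fun hzd => hcon
    (h'.eq_or_eq_of_adj (hmem i hil.le) (hmem _ (by omega)) (hmem _ (by omega)) hzd
      (h.toIsCyc.ne_of_lt (by omega) (by omega)) hprev (h.adj i) hz)
  have hsub : ¬ Set.range c ⊆ Set.range d := fun hs => by
    have := (hcd (l + 1) hl).1 (hs ⟨_, rfl⟩)
    omega
  have hsub' : ¬ Set.range d ⊆ Set.range c :=
    fun hs => hsub (h.range_subset_of_subset h'.toIsCyc hs)
  have hne : (Set.range d ∩ Set.range c).Nonempty := ⟨c 0, hmem 0 (by omega), 0, rfl⟩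
  have hconn := h'.setConn_diff h hK hsub' hne
  have hT₁ : Touch G (compIn G ((Set.range d)ᶜ \ (Set.range c \ Set.range d)) z)
      (Set.range c \ Set.range d) := by
    have h1 : c (l + 1) ∉ Set.range d := fun h1 => by
      have := (hcd (l + 1) hl).1 h1
      omega
    exact (h'.compl z hzd _ h1).touch_compIn (fun h2 => hzc h2.1) ⟨⟨_, rfl⟩, h1⟩
  obtain ⟨x, hx, hxc⟩ := Set.not_subset.1 hsub'
  have hT₂ : Touch G (compIn G ((Set.range c)ᶜ \ (Set.range d \ Set.range c)) z)
      (Set.range d \ Set.range c) :=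
    (h.compl z hzc x hxc).touch_compIn (fun h2 => hzd h2.1) ⟨hx, hxc⟩
  have he₁ : (Set.range d)ᶜ \ (Set.range c \ Set.range d) = (Set.range c ∪ Set.range d)ᶜ := by
    ext w; simp only [Set.mem_sdiff, Set.mem_compl_iff, Set.mem_union]; tauto
  have he₂ : (Set.range c)ᶜ \ (Set.range d \ Set.range c) = (Set.range c ∪ Set.range d)ᶜ := by
    ext w; simp only [Set.mem_sdiff, Set.mem_compl_iff, Set.mem_union]; tauto
  rw [he₁] at hT₁
  rw [he₂] at hT₂
  set K := compIn G (Set.range c ∪ Set.range d)ᶜ z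
  have hKs : K ⊆ (Set.range c ∪ Set.range d)ᶜ := compIn_subset
  have hKc : ∀ {A : Set V}, A ⊆ Set.range c ∪ Set.range d → Disjoint A K := fun hA =>
    Set.disjoint_left.2 fun y hy hyK => hKs hyK (hA hy)
  have harc : ∀ a b, c '' Set.Ico a b ⊆ Set.range c := by
    rintro a b _ ⟨j, _, rfl⟩
    exact ⟨j, rfl⟩
  have hdiff := h.toIsCyc.diff_eq_arc hcd
  have hds : ∀ a b, Disjoint (c '' Set.Ico a b) (Set.range d \ Set.range c) := fun a b =>
    Set.disjoint_left.2 fun y hy hy' => hy'.2 (harc a b hy)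
  have hsing : ({c i} : Set V) = c '' Set.Ico i (i + 1) := by
    rw [← Set.image_singleton]
    congr 1
    ext y
    simp only [Set.mem_singleton_iff, Set.mem_Ico]
    omega
  rw [hdiff] at hT₁
  refine hK (isMinor_completeBipartite_three (A₀ := c '' Set.Ico 0 i)
    (A₁ := c '' Set.Ico (i + 1) (l + 1)) (A₂ := K) (B₀ := c '' Set.Ico i (i + 1))
    (B₁ := c '' Set.Ico (l + 1) m) (B₂ := Set.range d \ Set.range c)
    ⟨h.toIsCyc.setConn_arc _ _, h.toIsCyc.setConn_arc _ _, setConn_compIn⟩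
    ⟨h.toIsCyc.setConn_arc _ _, h.toIsCyc.setConn_arc _ _, hconn⟩
    ⟨h.toIsCyc.disjoint_arc (by omega) (by omega), hKc ((harc _ _).trans Set.subset_union_left),
      hKc ((harc _ _).trans Set.subset_union_left)⟩
    ⟨h.toIsCyc.disjoint_arc (by omega) (by omega), hds _ _, hds _ _⟩
    ⟨h.toIsCyc.disjoint_arc (by omega) (by omega), h.toIsCyc.disjoint_arc (by omega) (by omega),
      hds _ _⟩
    ⟨(h.toIsCyc.disjoint_arc (by omega) (by omega)).symm,
      h.toIsCyc.disjoint_arc (by omega) (by omega), hds _ _⟩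
    ⟨(hKc ((harc _ _).trans Set.subset_union_left)).symm,
      (hKc ((harc _ _).trans Set.subset_union_left)).symm,
      (hKc (Set.sdiff_subset.trans Set.subset_union_right)).symm⟩
    ⟨h.toIsCyc.touch_arc hi (by omega), ?_, ?_⟩
    ⟨(h.toIsCyc.touch_arc (by omega) (by omega)).symm, h.toIsCyc.touch_arc (by omega) (by omega),
      ?_⟩
    ⟨?_, hT₁, hT₂⟩)
  · have := h.toIsCyc.touch_arc_wrap (i := 0) (j := i) (k := l + 1) hi (by omega)
    rw [zero_add] at this
    exact this.symm
  · refine (h.touch_diff_of_end h' hl hcd (Or.inl rfl)).mono ?_ subset_rfl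
    exact Set.singleton_subset_iff.2 ⟨0, ⟨le_rfl, hi⟩, rfl⟩
  · refine (h.touch_diff_of_end h' hl hcd (Or.inr rfl)).mono ?_ subset_rfl
    exact Set.singleton_subset_iff.2 ⟨l, ⟨by omega, by omega⟩, rfl⟩
  · rw [← hsing]
    exact ⟨z, mem_compIn_self fun h1 => h1.elim hzc hzd, _, rfl, hz.symm⟩

/-- Three peripheral cycles with a common edge: the intersection of two of them is contained in
the third. -/
theorem IsPeripheral.mem_of_common_edge {m n n' l : ℕ} {c d e : ℕ → V} (h : IsPeripheral G m c)
    (h' : IsPeripheral G n d) (h'' : IsPeripheral G n' e)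
    (hK : ¬ IsMinor (completeBipartiteGraph (Fin 3) (Fin 3)) G)
    (hl : l + 1 < m) (hcd : ∀ i < m, (c i ∈ Set.range d ↔ i ≤ l)) {a : ℕ} (ha : a + 1 ≤ l)
    (hae : c a ∈ Set.range e) (hae' : c (a + 1) ∈ Set.range e) {i : ℕ} (hi : i ≤ l) :
    c i ∈ Set.range e := by
  have step : ∀ b, 0 < b → b < l → c b ∈ Set.range e →
      c (b - 1) ∈ Set.range e ∧ c (b + 1) ∈ Set.range e := by
    intro b hb hbl hbe
    obtain ⟨y, hy, z, hz, hyz, h1, h2⟩ := h''.toIsCyc.exists_two_neighbors hbe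
    rcases h.eq_of_adj_of_inner h' hK hl hcd hb hbl h1 with rfl | rfl <;>
      rcases h.eq_of_adj_of_inner h' hK hl hcd hb hbl h2 with rfl | rfl <;> simp_all
  rcases le_or_gt i a with hia | hia
  · refine Nat.decreasingInduction (motive := fun i _ => c i ∈ Set.range e) ?_ hae hia
    intro k hk hke
    exact (step (k + 1) (by omega) (by omega) hke).1
  · have : ∀ j, a + 1 ≤ j → j ≤ l → c j ∈ Set.range e := by
      intro j hj
      induction j, hj using Nat.le_induction with
      | base => exact fun _ => hae'
      | succ j hj ih => exact fun hjl => (step j (by omega) (by omega) (ih (by omega))).2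
    exact this i hia hi

/-- Five connected sets arranged like two adjacent poles and three meridians cannot have pairwise
connected complements of the meridians in a planar graph. -/
theorem false_of_three_meridians {I₁ I₂ A₁ A₂ A₃ : Set V}
    (hK : ¬ IsMinor (completeBipartiteGraph (Fin 3) (Fin 3)) G)
    (hK' : ¬ IsMinor (completeGraph (Fin 5)) G)
    (hI : SetConn G I₁ ∧ SetConn G I₂) (hA : SetConn G A₁ ∧ SetConn G A₂ ∧ SetConn G A₃)
    (dI : Disjoint I₁ I₂) (tI : Touch G I₁ I₂)
    (dA : Disjoint A₁ A₂ ∧ Disjoint A₁ A₃ ∧ Disjoint A₂ A₃)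
    (d₁ : Disjoint I₁ A₁ ∧ Disjoint I₁ A₂ ∧ Disjoint I₁ A₃)
    (d₂ : Disjoint I₂ A₁ ∧ Disjoint I₂ A₂ ∧ Disjoint I₂ A₃)
    (t₁ : Touch G I₁ A₁ ∧ Touch G I₁ A₂ ∧ Touch G I₁ A₃)
    (t₂ : Touch G I₂ A₁ ∧ Touch G I₂ A₂ ∧ Touch G I₂ A₃)
    (c₁₂ : SetConn G (I₁ ∪ I₂ ∪ A₃)ᶜ) (c₁₃ : SetConn G (I₁ ∪ I₂ ∪ A₂)ᶜ)
    (c₂₃ : SetConn G (I₁ ∪ I₂ ∪ A₁)ᶜ) : False := by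
  set O : Set V := (I₁ ∪ I₂ ∪ A₁ ∪ A₂ ∪ A₃)ᶜ with hO
  have hOd : ∀ {B : Set V}, B ⊆ O → Disjoint I₁ B ∧ Disjoint I₂ B ∧ Disjoint A₁ B ∧
      Disjoint A₂ B ∧ Disjoint A₃ B := by
    intro B hB
    refine ⟨?_, ?_, ?_, ?_, ?_⟩ <;> refine Set.disjoint_left.2 fun y hy hyB => hB hyB ?_ <;>
      simp [hy]
  have hno : ∀ y, ¬ (Touch G (compIn G O y) A₁ ∧ Touch G (compIn G O y) A₂ ∧
      Touch G (compIn G O y) A₃) := by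
    rintro y ⟨h1, h2, h3⟩
    obtain ⟨e1, e2, e3, e4, e5⟩ := hOd (compIn_subset (G := G) (S := O) (x := y))
    exact hK (isMinor_completeBipartite_three ⟨hI.1, hI.2, setConn_compIn⟩ hA ⟨dI, e1, e2⟩ dA d₁ d₂
      ⟨e3.symm, e4.symm, e5.symm⟩ t₁ t₂ ⟨h1, h2, h3⟩)
  have conn : ∀ {A : Set V} (Q : V → Prop), SetConn G A → A.Nonempty →
      (∀ y, Q y → Touch G (compIn G O y) A) → (∀ y z, z ∈ compIn G O y → Q y → Q z) →
      SetConn G (A ∪ {y | y ∈ O ∧ Q y}) := by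
    intro A Q hA hAne hQ hQc
    obtain ⟨b, hb⟩ := hAne
    refine SetConn.of_base b ?_
    rintro y (hy | ⟨hyO, hy⟩)
    · exact (hA b hb y hy).mono Set.subset_union_left
    · obtain ⟨u, hu, a, ha, hua⟩ := hQ y hy
      have h1 : LinkedIn G (A ∪ {y | y ∈ O ∧ Q y}) y u := (LinkedIn.in_compIn hu).mono
        fun z hz => Or.inr ⟨compIn_subset hz, hQc y z hz hy⟩
      exact ((hA b hb a ha).mono Set.subset_union_left).trans
        (h1.snoc hua (Or.inl ha)).symm
  have pair : ∀ {A A' T : Set V}, SetConn G T → A.Nonempty → A'.Nonempty → Disjoint A A' →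
      T = A ∪ A' ∪ O → Touch G A A' ∨
      ∃ R : Set V, R ⊆ O ∧ SetConn G R ∧ Touch G R A ∧ Touch G R A' := by
    rintro A A' T hT ⟨x, hx⟩ ⟨y, hy⟩ hAA rfl
    rcases (hT x (by simp [hx]) y (by simp [hy])).excursion (D := A ∪ A') hx hy
      Set.subset_union_right hAA (fun z _ hz => hz) with
      ⟨a, ha, b, hb, hab⟩ | ⟨R, _, hR, hRs, h1, h2⟩
    · exact Or.inl ⟨a, ha.1, b, hb.1, hab⟩
    · refine Or.inr ⟨R, fun z hz => ?_, hR, h1.mono subset_rfl Set.inter_subset_left,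
        h2.mono subset_rfl Set.inter_subset_left⟩
      have := hRs hz
      simp only [Set.mem_sdiff, Set.mem_union] at this
      tauto
  have compT : ∀ {R A : Set V} {y : V}, R ⊆ O → SetConn G R → y ∈ R → Touch G R A →
      Touch G (compIn G O y) A := fun hRO hR hy h =>
    h.mono (fun z hz => (hR _ hy z hz).mono hRO) subset_rfl
  set P₁ : V → Prop := fun y => Touch G (compIn G O y) A₁
  set P₂ : V → Prop := fun y => Touch G (compIn G O y) A₂ ∧ ¬ Touch G (compIn G O y) A₁
  have s₁ : A₁ ⊆ A₁ ∪ {y | y ∈ O ∧ P₁ y} := Set.subset_union_left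
  have s₂ : A₂ ⊆ A₂ ∪ {y | y ∈ O ∧ P₂ y} := Set.subset_union_left
  have o₁ := hOd (show {y | y ∈ O ∧ P₁ y} ⊆ O from fun y hy => hy.1)
  have o₂ := hOd (show {y | y ∈ O ∧ P₂ y} ⊆ O from fun y hy => hy.1)
  have n₁ := t₁.1.symm.nonempty
  have n₂ := t₁.2.1.symm.nonempty
  have n₃ := t₁.2.2.symm.nonempty
  have compl_eq : ∀ {X A B : Set V}, Disjoint X A → Disjoint X B → O = (X ∪ A ∪ B)ᶜ →
      Xᶜ = A ∪ B ∪ O := by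
    rintro X A B hA hB h
    ext z
    have e1 := fun h : z ∈ X => Set.disjoint_left.1 hA h
    have e2 := fun h : z ∈ X => Set.disjoint_left.1 hB h
    simp only [h, Set.mem_compl_iff, Set.mem_union]
    tauto
  have eq₁₂ : (I₁ ∪ I₂ ∪ A₃)ᶜ = A₁ ∪ A₂ ∪ O :=
    compl_eq ((d₁.1.union_left d₂.1).union_left dA.2.1.symm)
      ((d₁.2.1.union_left d₂.2.1).union_left dA.2.2.symm) (by rw [hO]; congr 1; ac_rfl)
  have eq₁₃ : (I₁ ∪ I₂ ∪ A₂)ᶜ = A₁ ∪ A₃ ∪ O :=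
    compl_eq ((d₁.1.union_left d₂.1).union_left dA.1.symm)
      ((d₁.2.2.union_left d₂.2.2).union_left dA.2.2) (by rw [hO]; congr 1; ac_rfl)
  have eq₂₃ : (I₁ ∪ I₂ ∪ A₁)ᶜ = A₂ ∪ A₃ ∪ O :=
    compl_eq ((d₁.2.1.union_left d₂.2.1).union_left dA.1)
      ((d₁.2.2.union_left d₂.2.2).union_left dA.2.1) (by rw [hO])
  have dP : Disjoint {y | y ∈ O ∧ P₁ y} {y | y ∈ O ∧ P₂ y} :=
    Set.disjoint_left.2 fun y hy hy' => hy'.2.2 hy.2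
  refine hK' (isMinor_completeGraph_five (A₀ := I₁) (A₁ := I₂) (A₂ := A₁ ∪ {y | y ∈ O ∧ P₁ y})
    (A₃ := A₂ ∪ {y | y ∈ O ∧ P₂ y}) (A₄ := A₃)
    ⟨hI.1, hI.2, conn P₁ hA.1 n₁ (fun y hy => hy) (fun y z hz hy => ?_),
      conn P₂ hA.2.1 n₂ (fun y hy => hy.1) (fun y z hz hy => ?_), hA.2.2⟩
    ⟨dI, d₁.1.union_right o₁.1, d₁.2.1.union_right o₂.1, d₁.2.2⟩
    ⟨d₂.1.union_right o₁.2.1, d₂.2.1.union_right o₂.2.1, d₂.2.2⟩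
    ⟨(dA.1.union_right o₂.2.2.1).union_left (o₁.2.2.2.1.symm.union_right dP),
      dA.2.1.union_left o₁.2.2.2.2.symm⟩
    (dA.2.2.union_left o₂.2.2.2.2.symm)
    ⟨tI, t₁.1.mono subset_rfl s₁, t₁.2.1.mono subset_rfl s₂, t₁.2.2⟩
    ⟨t₂.1.mono subset_rfl s₁, t₂.2.1.mono subset_rfl s₂, t₂.2.2⟩
    ⟨?_, ?_⟩ ?_)
  · change Touch G (compIn G O z) A₁
    rw [compIn_eq_of_mem hz]
    exact hy
  · change Touch G (compIn G O z) A₂ ∧ ¬ Touch G (compIn G O z) A₁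
    rw [compIn_eq_of_mem hz]
    exact hy
  · rcases pair c₁₂ n₁ n₂ dA.1 eq₁₂ with ht | ⟨R, hRO, hR, r1, r2⟩
    · exact ht.mono s₁ s₂
    · exact r2.mono (fun y hy => Or.inr ⟨hRO hy, compT hRO hR hy r1⟩) s₂
  · rcases pair c₁₃ n₁ n₃ dA.2.1 eq₁₃ with ht | ⟨R, hRO, hR, r1, r2⟩
    · exact ht.mono s₁ subset_rfl
    · exact r2.mono (fun y hy => Or.inr ⟨hRO hy, compT hRO hR hy r1⟩) subset_rfl
  · rcases pair c₂₃ n₂ n₃ dA.2.2 eq₂₃ with ht | ⟨R, hRO, hR, r1, r2⟩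
    · exact ht.mono s₂ subset_rfl
    · refine r2.mono (fun y hy => Or.inr ⟨hRO hy, compT hRO hR hy r1, fun h1 => ?_⟩) subset_rfl
      exact hno y ⟨h1, compT hRO hR hy r1, compT hRO hR hy r2⟩

/-- In a graph without Kuratowski minors an edge lies on at most two peripheral cycles. -/
theorem IsPeripheral.not_three {m n n' : ℕ} {c d e : ℕ → V} (h : IsPeripheral G m c)
    (h' : IsPeripheral G n d) (h'' : IsPeripheral G n' e)
    (hK : ¬ IsMinor (completeBipartiteGraph (Fin 3) (Fin 3)) G)
    (hK' : ¬ IsMinor (completeGraph (Fin 5)) G) (hcd : Set.range c ≠ Set.range d)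
    (hce : Set.range c ≠ Set.range e) (hde : Set.range d ≠ Set.range e) {x y : V}
    (hxy : G.Adj x y) (hx : x ∈ Set.range c ∧ x ∈ Set.range d ∧ x ∈ Set.range e)
    (hy : y ∈ Set.range c ∧ y ∈ Set.range d ∧ y ∈ Set.range e) : False := by
  have main : ∀ {m n n' : ℕ} {c d e : ℕ → V} (_ : IsPeripheral G m c) (_ : IsPeripheral G n d)
      (_ : IsPeripheral G n' e) (_ : Set.range c ≠ Set.range d)
      (_ : x ∈ Set.range c ∧ x ∈ Set.range d ∧ x ∈ Set.range e)
      (_ : y ∈ Set.range c ∧ y ∈ Set.range d ∧ y ∈ Set.range e),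
      ∃ k l, 1 ≤ l ∧ l + 1 < m ∧ (∀ i < m, (c (i + k) ∈ Set.range d ↔ i ≤ l)) ∧
        ∀ i ≤ l, c (i + k) ∈ Set.range e := by
    intro m n n' c d e h h' h'' hcd hx hy
    have hsub : ¬ Set.range c ⊆ Set.range d := fun hs =>
      hcd (hs.antisymm (h'.range_subset_of_subset h.toIsCyc hs))
    obtain ⟨k, l, hl, hkl⟩ := h.exists_overlap h' hK hsub ⟨x, hx.1, hx.2.1⟩
    have hs := h.shift k
    rw [← h.toIsCyc.range_shift k] at hx hy
    have hedge : ∃ a, a + 1 ≤ l ∧ c (a + k) ∈ Set.range e ∧ c (a + 1 + k) ∈ Set.range e := by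
      obtain ⟨a, -, ha, hax⟩ := hs.toIsCyc.exists_window hx.1 0
      obtain ⟨b, -, hb, hby⟩ := hs.toIsCyc.exists_window hy.1 0
      rw [zero_add] at ha hb
      have hal : a ≤ l := (hkl a ha).1 (by rw [show c (a + k) = x from hax]; exact hx.2.1)
      have hbl : b ≤ l := (hkl b hb).1 (by rw [show c (b + k) = y from hby]; exact hy.2.1)
      rcases hs.chordless a b (by rw [hax, hby]; exact hxy) with he | he
      · have := hs.toIsCyc.inj b (a + 1) hb (by omega) he
        subst this
        exact ⟨a, hbl, by rw [show c (a + k) = x from hax]; exact hx.2.2,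
          by rw [show c (a + 1 + k) = y from hby]; exact hy.2.2⟩
      · have := hs.toIsCyc.inj a (b + 1) ha (by omega) he
        subst this
        exact ⟨b, hal, by rw [show c (b + k) = y from hby]; exact hy.2.2,
          by rw [show c (b + 1 + k) = x from hax]; exact hx.2.2⟩
    obtain ⟨a, ha, h1, h2⟩ := hedge
    exact ⟨k, l, by omega, hl, hkl, fun i hi =>
      hs.mem_of_common_edge h' h'' hK hl hkl ha h1 h2 hi⟩
  have sub : ∀ {m n n' : ℕ} {c d e : ℕ → V} (_ : IsPeripheral G m c) (_ : IsPeripheral G n d)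
      (_ : IsPeripheral G n' e) (_ : Set.range c ≠ Set.range d)
      (_ : x ∈ Set.range c ∧ x ∈ Set.range d ∧ x ∈ Set.range e)
      (_ : y ∈ Set.range c ∧ y ∈ Set.range d ∧ y ∈ Set.range e) (z : V),
      z ∈ Set.range c → z ∈ Set.range d → z ∈ Set.range e := by
    intro m n n' c d e h h' h'' hcd hx hy z hz hzd
    obtain ⟨k, l, -, -, hkl, hke⟩ := main h h' h'' hcd hx hy
    rw [← h.toIsCyc.range_shift k] at hz
    obtain ⟨i, -, hi, rfl⟩ := (h.shift k).toIsCyc.exists_window hz 0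
    exact hke i ((hkl i (by omega)).1 hzd)
  obtain ⟨k, l, hl1, hl, hkl, hke⟩ := main h h' h'' hcd hx hy
  have r₁ := sub h h' h'' hcd hx hy
  have r₂ := sub h h'' h' hce ⟨hx.1, hx.2.2, hx.2.1⟩ ⟨hy.1, hy.2.2, hy.2.1⟩
  have r₃ := sub h' h'' h hde ⟨hx.2.1, hx.2.2, hx.1⟩ ⟨hy.2.1, hy.2.2, hy.1⟩
  have inc : ∀ {m n : ℕ} {c d : ℕ → V} (_ : IsPeripheral G m c) (_ : IsPeripheral G n d)
      (_ : Set.range c ≠ Set.range d), ¬ Set.range c ⊆ Set.range d := fun h h' hne hs =>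
    hne (hs.antisymm (h'.range_subset_of_subset h.toIsCyc hs))
  have hs := h.shift k
  have hkle : ∀ i < m, (c (i + k) ∈ Set.range e ↔ i ≤ l) := fun i hi =>
    ⟨fun h1 => (hkl i hi).1 (r₂ _ ⟨_, rfl⟩ h1), hke i⟩
  have cA₁ := h.setConn_diff h' hK (inc h h' hcd) ⟨x, hx.1, hx.2.1⟩
  have cA₂ := h'.setConn_diff h hK (inc h' h hcd.symm) ⟨x, hx.2.1, hx.1⟩
  have cA₃ := h''.setConn_diff h hK (inc h'' h hce.symm) ⟨x, hx.2.2, hx.1⟩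
  have hrange := h.toIsCyc.range_shift k
  set f : ℕ → V := fun i => c (i + k) with hf
  rw [← hrange] at r₁ r₂ r₃ cA₁ cA₂ cA₃
  have hdiff := hs.toIsCyc.diff_eq_arc hkl
  have hI : Set.range f ∩ Set.range d = f '' Set.Ico 0 1 ∪ f '' Set.Ico 1 (l + 1) := by
    rw [hs.toIsCyc.range_eq_image 0, ← Set.image_union]
    ext z
    constructor
    · rintro ⟨⟨i, hi, rfl⟩, hz⟩
      have := (hkl i (by simpa using hi.2)).1 hz
      refine ⟨i, ?_, rfl⟩
      simp only [Set.mem_union, Set.mem_Ico]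
      omega
    · rintro ⟨i, hi, rfl⟩
      simp only [Set.mem_union, Set.mem_Ico] at hi
      exact ⟨⟨i, ⟨by omega, by omega⟩, rfl⟩, (hkl i (by omega)).2 (by omega)⟩
  have sing0 : ({f 0} : Set V) ⊆ f '' Set.Ico 0 1 :=
    Set.singleton_subset_iff.2 ⟨0, by simp, rfl⟩
  have singl : ({f l} : Set V) ⊆ f '' Set.Ico 1 (l + 1) :=
    Set.singleton_subset_iff.2 ⟨l, by simp; omega, rfl⟩
  have sub₁ : f '' Set.Ico 0 1 ⊆ Set.range f ∩ Set.range d := hI ▸ Set.subset_union_left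
  have sub₂ : f '' Set.Ico 1 (l + 1) ⊆ Set.range f ∩ Set.range d :=
    hI ▸ Set.subset_union_right
  have dj : ∀ {B : Set V}, B ⊆ Set.range f ∩ Set.range d →
      Disjoint B (Set.range f \ Set.range d) ∧ Disjoint B (Set.range d \ Set.range f) ∧
      Disjoint B (Set.range e \ Set.range f) := fun hB =>
    ⟨Set.disjoint_left.2 fun z hz hz' => hz'.2 (hB hz).2,
      Set.disjoint_left.2 fun z hz hz' => hz'.2 (hB hz).1,
      Set.disjoint_left.2 fun z hz hz' => hz'.2 (hB hz).1⟩
  refine false_of_three_meridians (I₁ := f '' Set.Ico 0 1) (I₂ := f '' Set.Ico 1 (l + 1))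
    (A₁ := Set.range f \ Set.range d) (A₂ := Set.range d \ Set.range f)
    (A₃ := Set.range e \ Set.range f) hK hK' ⟨hs.toIsCyc.setConn_arc _ _,
    hs.toIsCyc.setConn_arc _ _⟩ ⟨cA₁, cA₂, cA₃⟩ (hs.toIsCyc.disjoint_arc le_rfl (by omega))
    (hs.toIsCyc.touch_arc (by omega) (by omega))
    ⟨Set.disjoint_left.2 fun z hz hz' => hz'.2 hz.1,
      Set.disjoint_left.2 fun z hz hz' => hz'.2 hz.1,
      Set.disjoint_left.2 fun z hz hz' => hz.2 (r₃ z hz.1 hz'.1)⟩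
    (dj sub₁) (dj sub₂)
    ⟨?_, (hs.touch_diff_of_end h' hl hkl (Or.inl rfl)).mono sing0 subset_rfl,
      (hs.touch_diff_of_end h'' hl hkle (Or.inl rfl)).mono sing0 subset_rfl⟩
    ⟨?_, (hs.touch_diff_of_end h' hl hkl (Or.inr rfl)).mono singl subset_rfl,
      (hs.touch_diff_of_end h'' hl hkle (Or.inr rfl)).mono singl subset_rfl⟩ ?_ ?_ ?_
  · rw [hdiff]
    have := hs.toIsCyc.touch_arc_wrap (i := 0) (j := 1) (k := l + 1) (by omega) (by omega)
    rw [zero_add] at this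
    exact this.symm
  · rw [hdiff]
    exact hs.toIsCyc.touch_arc (by omega) (by omega)
  · rw [← hI]
    convert h''.compl using 2
    ext z
    have e1 := r₁ z
    have e2 := r₂ z
    simp only [Set.mem_union, Set.mem_inter_iff, Set.mem_sdiff]
    tauto
  · rw [← hI]
    convert h'.compl using 2
    ext z
    simp only [Set.mem_union, Set.mem_inter_iff, Set.mem_sdiff]
    tauto
  · rw [← hI]
    convert hs.compl using 2
    ext z
    simp only [Set.mem_union, Set.mem_inter_iff, Set.mem_sdiff]
    tauto

end ThreeFaces

section Chains

variable {V : Type} {G : SimpleGraph V}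

open Classical in
/-- The chain with coefficient one at the edge `e`. -/
noncomputable def edgeChain (e : Sym2 V) : Sym2 V → ZMod 2 := Pi.single e 1

/-- The sum modulo two of the edges of a walk. -/
noncomputable def walkChain {x y : V} (w : G.Walk x y) : Sym2 V → ZMod 2 :=
  (w.edges.map edgeChain).sum

theorem chain_add_self (f : Sym2 V → ZMod 2) : f + f = 0 :=
  funext fun _ => CharTwo.add_self_eq_zero _

@[simp]
theorem walkChain_nil {x : V} : walkChain (Walk.nil : G.Walk x x) = 0 := by simp [walkChain]

@[simp]
theorem walkChain_cons {x y z : V} (h : G.Adj x y) (w : G.Walk y z) :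
    walkChain (Walk.cons h w) = edgeChain s(x, y) + walkChain w := by simp [walkChain]

@[simp]
theorem walkChain_append {x y z : V} (w : G.Walk x y) (w' : G.Walk y z) :
    walkChain (w.append w') = walkChain w + walkChain w' := by
  simp [walkChain, Walk.edges_append]

@[simp]
theorem walkChain_reverse {x y : V} (w : G.Walk x y) : walkChain w.reverse = walkChain w := by
  simp [walkChain, Walk.edges_reverse, List.sum_reverse]

/-- The sum of the edges `c l, c (l + 1)` with `i ≤ l < j`. -/
noncomputable def arcChain (c : ℕ → V) (i j : ℕ) : Sym2 V → ZMod 2 :=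
  ∑ l ∈ Finset.Ico i j, edgeChain s(c l, c (l + 1))

theorem arcChain_add (c : ℕ → V) {i j k : ℕ} (hij : i ≤ j) (hjk : j ≤ k) :
    arcChain c i j + arcChain c j k = arcChain c i k := Finset.sum_Ico_consecutive _ hij hjk

theorem walkChain_eq_arcChain {x y : V} (w : G.Walk x y) :
    walkChain w = arcChain w.getVert 0 w.length := by
  induction w with
  | nil => simp [arcChain]
  | cons h w ih =>
    rw [walkChain_cons, ih, arcChain, arcChain, Walk.length_cons, ← Finset.range_eq_Ico,
      ← Finset.range_eq_Ico, Finset.sum_range_succ', add_comm]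
    simp

/-- A closed sequence of distinct consecutively adjacent vertices is a cycle. -/
theorem IsCyc.of_closed {m : ℕ} {f : ℕ → V} (hm : 3 ≤ m)
    (hadj : ∀ i, i + 1 < m → G.Adj (f i) (f (i + 1))) (hlast : G.Adj (f (m - 1)) (f 0))
    (hinj : ∀ i j, i < m → j < m → f i = f j → i = j) :
    IsCyc G m (fun i => f (i % m)) where
  three_le := hm
  periodic i := by simp
  adj i := by
    have hlt := Nat.mod_lt i (show m > 0 by omega)
    rcases eq_or_ne (i % m + 1) m with h | h
    · have h1 : (i + 1) % m = 0 := by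
        rw [Nat.add_mod, Nat.mod_eq_of_lt (show 1 < m by omega), h, Nat.mod_self]
      rw [h1, show i % m = m - 1 by omega]
      exact hlast
    · have h1 : (i + 1) % m = i % m + 1 := by
        rw [Nat.add_mod, Nat.mod_eq_of_lt (show 1 < m by omega), Nat.mod_eq_of_lt (by omega)]
      rw [h1]
      exact hadj _ (by omega)
  inj i j hi hj h := by
    simp only [Nat.mod_eq_of_lt hi, Nat.mod_eq_of_lt hj] at h
    exact hinj i j hi hj h

theorem arcChain_mod {m : ℕ} (hm : 0 < m) (f : ℕ → V) :
    arcChain (fun i => f (i % m)) 0 m = arcChain f 0 (m - 1) + edgeChain s(f (m - 1), f 0) := by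
  obtain ⟨n, rfl⟩ : ∃ n, m = n + 1 := ⟨m - 1, by omega⟩
  rw [arcChain, arcChain, ← Finset.range_eq_Ico, ← Finset.range_eq_Ico, Finset.sum_range_succ]
  congr 1
  · refine Finset.sum_congr rfl fun l hl => ?_
    have := Finset.mem_range.1 hl
    rw [Nat.mod_eq_of_lt (by omega), Nat.mod_eq_of_lt (by omega)]
  · simp

theorem IsCyc.arcChain_window {m : ℕ} {c : ℕ → V} (h : IsCyc G m c) (k : ℕ) :
    arcChain c k (k + m) = arcChain c 0 m := by
  induction k with
  | zero => rw [zero_add]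
  | succ k ih =>
    rw [← ih]
    have hm := h.three_le
    have h1 : arcChain c k (k + m) = edgeChain s(c k, c (k + 1)) + arcChain c (k + 1) (k + m) := by
      rw [← arcChain_add c (show k ≤ k + 1 by omega) (show k + 1 ≤ k + m by omega)]
      simp [arcChain]
    have h2 : arcChain c (k + 1) (k + 1 + m) =
        arcChain c (k + 1) (k + m) + edgeChain s(c k, c (k + 1)) := by
      rw [← arcChain_add c (show k + 1 ≤ k + m by omega) (show k + m ≤ k + 1 + m by omega)]
      congr 1
      rw [show k + 1 + m = k + m + 1 by omega, arcChain, Nat.Ico_succ_singleton,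
        Finset.sum_singleton, h.periodic, show k + m + 1 = k + 1 + m by omega, h.periodic]
    rw [h1, h2, add_comm]

theorem IsCyc.arcChain_shift {m : ℕ} {c : ℕ → V} (h : IsCyc G m c) (k : ℕ) :
    arcChain (fun i => c (i + k)) 0 m = arcChain c 0 m := by
  rw [← h.arcChain_window k, arcChain, arcChain, Finset.sum_Ico_eq_sum_range,
    Finset.sum_Ico_eq_sum_range, Nat.add_sub_cancel_left, Nat.sub_zero]
  refine Finset.sum_congr rfl fun l _ => ?_
  rw [zero_add, add_comm k l, add_right_comm]

/-- A walk along an arc of a cycle. -/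
theorem IsCyc.exists_arcWalk {m : ℕ} {c : ℕ → V} (h : IsCyc G m c) {i j : ℕ} (hij : i ≤ j) :
    ∃ w : G.Walk (c i) (c j), walkChain w = arcChain c i j ∧
      ∀ z ∈ w.support, z ∈ c '' Set.Icc i j := by
  induction j, hij using Nat.le_induction with
  | base => exact ⟨.nil, by simp [arcChain], by simp⟩
  | succ j hij ih =>
    obtain ⟨w, hw, hs⟩ := ih
    refine ⟨w.append (h.adj j).toWalk, ?_, fun z hz => ?_⟩
    · rw [walkChain_append, hw, ← arcChain_add c hij (Nat.le_succ j)]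
      simp [arcChain]
    · rcases (Walk.mem_support_append_iff _ _).1 hz with hz | hz
      · exact Set.image_mono (Set.Icc_subset_Icc_right (by omega)) (hs z hz)
      · simp only [Walk.support_cons, Walk.support_nil, List.mem_cons, List.not_mem_nil,
          or_false] at hz
        rcases hz with rfl | rfl
        exacts [⟨j, ⟨hij, by omega⟩, rfl⟩, ⟨j + 1, ⟨by omega, le_rfl⟩, rfl⟩]

/-- All closed walks inside `T` have their chain in `M`. -/
def ClosedIn (G : SimpleGraph V) (M : Submodule (ZMod 2) (Sym2 V → ZMod 2)) (T : Set V) : Prop :=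
  ∀ ⦃x : V⦄ (w : G.Walk x x), (∀ z ∈ w.support, z ∈ T) → walkChain w ∈ M

variable {M : Submodule (ZMod 2) (Sym2 V → ZMod 2)}

theorem ClosedIn.anti {T T' : Set V} (h : ClosedIn G M T) (hT : T' ⊆ T) : ClosedIn G M T' :=
  fun _ w hw => h w fun z hz => hT (hw z hz)

/-- It suffices to control the cycles. -/
theorem ClosedIn.of_cycles {T : Set V}
    (h : ∀ m c, IsCyc G m c → Set.range c ⊆ T → arcChain c 0 m ∈ M) : ClosedIn G M T := by
  classical
  have close : ∀ {x y : V} (hxy : G.Adj x y) (q : G.Walk y x), q.IsPath →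
      (∀ z ∈ q.support, z ∈ T) → edgeChain s(x, y) + walkChain q ∈ M := by
    intro x y hxy q hq hqT
    rcases lt_or_ge q.length 2 with hl | hl
    · have h1 : q.length = 1 := by
        have : q.length ≠ 0 := fun h0 => hxy.ne (Walk.eq_of_length_eq_zero h0).symm
        omega
      have h2 : walkChain q = edgeChain s(y, x) := by
        rw [walkChain_eq_arcChain, h1]
        have hx : q.getVert 1 = x := by rw [← h1, Walk.getVert_length]
        simp [arcChain, hx]
      rw [h2, Sym2.eq_swap, chain_add_self]
      exact M.zero_mem
    · have hcyc : IsCyc G (q.length + 1) (fun i => q.getVert (i % (q.length + 1))) := by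
        refine IsCyc.of_closed (by omega) (fun i hi => q.adj_getVert_succ (by omega)) ?_ ?_
        · simpa using hxy
        · exact fun i j hi hj hij => hq.getVert_injOn (by simp; omega) (by simp; omega) hij
      have h1 := h _ _ hcyc (by
        rintro _ ⟨i, rfl⟩
        exact hqT _ (q.getVert_mem_support _))
      rw [arcChain_mod (by omega), Nat.add_sub_cancel, ← walkChain_eq_arcChain,
        Walk.getVert_length, Walk.getVert_zero, add_comm] at h1
      exact h1
  have key : ∀ {x y : V} (w : G.Walk x y), (∀ z ∈ w.support, z ∈ T) →
      ∃ p : G.Walk x y, p.IsPath ∧ (∀ z ∈ p.support, z ∈ T) ∧ walkChain w + walkChain p ∈ M := by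
    intro x y w
    induction w with
    | nil => exact fun hw => ⟨.nil, by simp, hw, by simp⟩
    | @cons x x' y hadj w ih =>
      intro hw
      simp only [Walk.support_cons, List.mem_cons, forall_eq_or_imp] at hw
      obtain ⟨p, hp, hpT, hpM⟩ := ih hw.2
      by_cases hx : x ∈ p.support
      · refine ⟨p.dropUntil x hx, hp.dropUntil hx,
          fun z hz => hpT z (p.support_dropUntil_subset_support hx hz), ?_⟩
        have h1 := close hadj (p.takeUntil x hx) (hp.takeUntil hx)
          fun z hz => hpT z (p.support_takeUntil_subset_support hx hz)
        have h2 : walkChain p = walkChain (p.takeUntil x hx) + walkChain (p.dropUntil x hx) := by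
          rw [← walkChain_append, Walk.take_spec]
        rw [h2] at hpM
        have h3 := M.add_mem h1 hpM
        have h4 := chain_add_self (walkChain (p.takeUntil x hx))
        rw [walkChain_cons]
        convert h3 using 1
        linear_combination (exp := 1) -h4
      · refine ⟨.cons hadj p, hp.cons hx, ?_, ?_⟩
        · simpa using ⟨hw.1, hpT⟩
        · rw [walkChain_cons, walkChain_cons]
          have h4 := chain_add_self (edgeChain s(x, x'))
          convert hpM using 1
          linear_combination (exp := 1) h4
  intro x w hw
  obtain ⟨p, hp, _, hM⟩ := key w hw
  rw [(Walk.isPath_iff_nil.1 hp).eq_nil] at hM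
  simpa using hM

/-- Splitting a cycle along a tripod. -/
theorem IsCyc.arcChain_mem_of_tripod {m : ℕ} {c : ℕ → V} (h : IsCyc G m c) {i j k : ℕ}
    (hij : i ≤ j) (hjk : j ≤ k) (hk : k ≤ i + m) {S : Set V} {y : V}
    (hi : LinkedIn G (S ∪ {c i}) y (c i)) (hj : LinkedIn G (S ∪ {c j}) y (c j))
    (hk' : LinkedIn G (S ∪ {c k}) y (c k))
    (h₁ : ClosedIn G M (c '' Set.Icc i j ∪ S)) (h₂ : ClosedIn G M (c '' Set.Icc j k ∪ S))
    (h₃ : ClosedIn G M (c '' Set.Icc k (i + m) ∪ S)) : arcChain c 0 m ∈ M := by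
  have part : ∀ {a b : ℕ} (_ : a ≤ b) (wa : G.Walk y (c a)) (wb : G.Walk y (c b)),
      (∀ z ∈ wa.support, z ∈ S ∪ {c a}) → (∀ z ∈ wb.support, z ∈ S ∪ {c b}) →
      ClosedIn G M (c '' Set.Icc a b ∪ S) →
      walkChain wa + arcChain c a b + walkChain wb ∈ M := by
    intro a b hab wa wb ha hb hM
    obtain ⟨w, hw, hs⟩ := h.exists_arcWalk hab
    have mem : ∀ {e z}, a ≤ e → e ≤ b → z ∈ S ∪ {c e} → z ∈ c '' Set.Icc a b ∪ S := by
      rintro e z hae heb (hz | rfl)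
      exacts [Or.inr hz, Or.inl ⟨e, ⟨hae, heb⟩, rfl⟩]
    have := hM ((wa.append w).append wb.reverse) (fun z hz => by
      rcases (Walk.mem_support_append_iff _ _).1 hz with hz | hz
      · rcases (Walk.mem_support_append_iff _ _).1 hz with hz | hz
        exacts [mem le_rfl hab (ha z hz), Or.inl (hs z hz)]
      · exact mem hab le_rfl (hb z (by simpa using hz)))
    simpa [hw] using this
  obtain ⟨wi, si⟩ := hi
  obtain ⟨wj, sj⟩ := hj
  obtain ⟨wk, sk⟩ := hk'
  have e : c (i + m) = c i := h.periodic i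
  have p₁ := part hij wi wj si sj h₁
  have p₂ := part hjk wj wk sj sk h₂
  have p₃ := part hk wk (wi.copy rfl e.symm) sk (by simpa [e] using si) h₃
  have e' : walkChain (wi.copy rfl e.symm) = walkChain wi := by simp [walkChain]
  rw [e'] at p₃
  have := M.add_mem (M.add_mem p₁ p₂) p₃
  rw [← h.arcChain_window i, ← arcChain_add c (hij.trans hjk) hk, ← arcChain_add c hij hjk]
  convert this using 1
  linear_combination (exp := 1) -chain_add_self (walkChain wi) - chain_add_self (walkChain wj) -
    chain_add_self (walkChain wk)

/-- Splitting a cycle along a path. -/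
theorem IsCyc.arcChain_mem_of_link {m : ℕ} {c : ℕ → V} (h : IsCyc G m c) {i j : ℕ}
    (hij : i ≤ j) (hj : j ≤ i + m) {S : Set V} (hS : LinkedIn G S (c i) (c j))
    (h₁ : ClosedIn G M (c '' Set.Icc i j ∪ S)) (h₂ : ClosedIn G M (c '' Set.Icc j (i + m) ∪ S)) :
    arcChain c 0 m ∈ M := by
  refine h.arcChain_mem_of_tripod hij hj le_rfl (LinkedIn.refl (by simp))
    (hS.mono Set.subset_union_left) (by rw [h.periodic]; exact LinkedIn.refl (by simp))
    h₁ h₂ (h₁.anti ?_)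
  rw [Set.Icc_self, Set.image_singleton, h.periodic]
  refine Set.union_subset (Set.singleton_subset_iff.2 (Or.inl ⟨i, by simpa using hij, rfl⟩))
    Set.subset_union_right

end Chains

section Reduced

variable {V : Type} {G : SimpleGraph V}

theorem eq_or_eq_or_eq_of_pair {α : Type*} {p q x y z : α} (hx : x = p ∨ x = q)
    (hy : y = p ∨ y = q) (hz : z = p ∨ z = q) : x = y ∨ x = z ∨ y = z := by
  rcases hx with rfl | rfl <;> rcases hy with rfl | rfl <;> rcases hz with rfl | rfl <;> simp

/-- Graphs of girth at least six and minimum degree at least two which are not separated by two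
vertices into parts with at least two vertices each. -/
structure Reduced (G : SimpleGraph V) : Prop where
  girth : ∀ m c, IsCyc G m c → 6 ≤ m
  two : ∀ v, ∃ x y, x ≠ y ∧ G.Adj v x ∧ G.Adj v y
  sep : ∀ (p q : V) (X : Set V), p ∉ X → q ∉ X →
    (∀ x ∈ X, ∀ y, G.Adj x y → y ∈ X ∨ y = p ∨ y = q) →
    X.Subsingleton ∨ (X ∪ {p, q})ᶜ.Subsingleton

/-- The vertex `v` has at least three neighbors. -/
def Branching (G : SimpleGraph V) (v : V) : Prop := ∀ p q, ∃ z, G.Adj v z ∧ z ≠ p ∧ z ≠ q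

theorem IsCyc.branching {m : ℕ} {c : ℕ → V} (h : IsCyc G m c) {i : ℕ} (hi : 0 < i) {z : V}
    (hz : G.Adj (c i) z) (h₁ : z ≠ c (i - 1)) (h₂ : z ≠ c (i + 1)) : Branching G (c i) := by
  intro p q
  have hm := h.three_le
  have hne : c (i - 1) ≠ c (i + 1) := h.ne_of_lt (by omega) (by omega)
  have hprev : G.Adj (c i) (c (i - 1)) := by
    have := h.adj (i - 1)
    rw [Nat.sub_add_cancel hi] at this
    exact this.symm
  by_contra! hcon
  have key : ∀ w, G.Adj (c i) w → w = p ∨ w = q := fun w hw => or_iff_not_imp_left.2 (hcon w hw)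
  rcases eq_or_eq_or_eq_of_pair (key z hz) (key _ hprev) (key _ (h.adj i)) with h3 | h3 | h3
  exacts [h₁ h3, h₂ h3, hne h3]

namespace Reduced

variable {m : ℕ} {c : ℕ → V}

theorem add_five_le_of_chord (hR : Reduced G) (h : IsCyc G m c) {i k : ℕ} (hik : i + 2 ≤ k)
    (hk : k < i + m) (hadj : G.Adj (c k) (c i)) : i + 5 ≤ k := by
  have := hR.girth _ _ (IsCyc.of_closed (m := k - i + 1) (f := fun l => c (l + i)) (by omega)
    (fun l _ => by rw [add_right_comm]; exact h.adj _)
    (by simpa [Nat.sub_add_cancel (show i ≤ k by omega)] using hadj)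
    (fun a b ha hb hab => by
      have := h.eq_of_window (k := i) (by omega) (by omega) (by omega) (by omega) hab
      omega))
  omega

theorem add_four_le_of_ear (hR : Reduced G) (h : IsCyc G m c) {i k : ℕ} (hik : i < k)
    (hk : k < i + m) {w : V} (hw : w ∉ Set.range c) (hkw : G.Adj (c k) w)
    (hwi : G.Adj w (c i)) : i + 4 ≤ k := by
  have := hR.girth _ _ (IsCyc.of_closed (m := k - i + 2)
    (f := fun l => if l ≤ k - i then c (l + i) else w) (by omega)
    (fun l hl => by
      rcases Nat.lt_or_ge l (k - i) with h1 | h1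
      · rw [if_pos (by omega), if_pos (by omega), add_right_comm]
        exact h.adj _
      · rw [if_pos (by omega), if_neg (by omega), show l + i = k by omega]
        exact hkw)
    (by
      rw [if_neg (by omega), if_pos (by omega), zero_add]
      exact hwi)
    (fun a b ha hb hab => by
      split_ifs at hab with h1 h2 h2
      · have := h.eq_of_window (k := i) (by omega) (by omega) (by omega) (by omega) hab
        omega
      · exact absurd ⟨_, hab⟩ hw
      · exact absurd ⟨_, hab.symm⟩ hw
      · omega))
  omega

theorem connected [Nonempty V] (hR : Reduced G) : G.Connected := by
  refine ⟨fun x y => ?_⟩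
  by_contra hxy
  have hcl : ∀ u, G.Reachable x u → ∀ w, G.Adj u w → G.Reachable x w :=
    fun u hu w huw => hu.trans huw.reachable
  rcases hR.sep y y {u | G.Reachable x u} hxy hxy
    (fun u hu w huw => Or.inl (hcl u hu w huw)) with h | h
  · obtain ⟨a, _, _, ha, _⟩ := hR.two x
    exact ha.ne (h (Reachable.refl x) ha.reachable)
  · obtain ⟨a, b, hab, ha, hb⟩ := hR.two y
    refine hab (h ?_ ?_)
    · rintro (h1 | h1)
      · exact hxy (hcl a h1 y ha.symm)
      · exact ha.ne (Eq.symm (by simpa using h1))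
    · rintro (h1 | h1)
      · exact hxy (hcl b h1 y hb.symm)
      · exact hb.ne (Eq.symm (by simpa using h1))

theorem exists_isCyc [Finite V] [Nonempty V] (hR : Reduced G) : ∃ m c, IsCyc G m c := by
  classical
  have := Fintype.ofFinite V
  have hac : ¬ G.IsAcyclic := by
    intro hac
    obtain ⟨v⟩ := ‹Nonempty V›
    obtain ⟨x, _, _, hx, _⟩ := hR.two v
    have : Nontrivial V := ⟨v, x, hx.ne⟩
    have htree : G.IsTree := ⟨hR.connected, hac⟩
    obtain ⟨u, hu⟩ := htree.exists_vert_degree_one_of_nontrivial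
    obtain ⟨a, b, hab, ha, hb⟩ := hR.two u
    rw [← card_neighborFinset_eq_degree, Finset.card_eq_one] at hu
    obtain ⟨y, hy⟩ := hu
    have ha' : a ∈ G.neighborFinset u := by simpa using ha
    have hb' : b ∈ G.neighborFinset u := by simpa using hb
    rw [hy, Finset.mem_singleton] at ha' hb'
    exact hab (ha'.trans hb'.symm)
  simp only [IsAcyclic, not_forall, not_not] at hac
  obtain ⟨v, w, hw⟩ := hac
  have h3 := hw.three_le_length
  refine ⟨w.length, _, IsCyc.of_closed (f := w.getVert) h3
    (fun i hi => w.adj_getVert_succ (by omega)) ?_ fun i j hi hj hij =>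
      hw.getVert_injOn' (by simp; omega) (by simp; omega) hij⟩
  have := w.adj_getVert_succ (i := w.length - 1) (by omega)
  rw [Nat.sub_add_cancel (by omega), Walk.getVert_length] at this
  rwa [Walk.getVert_zero]

theorem six_le_card [Fintype V] [Nonempty V] (hR : Reduced G) : 6 ≤ Fintype.card V := by
  obtain ⟨m, c, h⟩ := hR.exists_isCyc
  have := Fintype.card_le_of_injective (fun i : Fin m => c i)
    fun i j hij => Fin.ext (h.inj i j i.2 j.2 hij)
  rw [Fintype.card_fin] at this
  exact (hR.girth m c h).trans this

theorem exists_of_not_branching (hR : Reduced G) {x y : V} (hx : ¬ Branching G x)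
    (hxy : G.Adj x y) : ∃ p, p ≠ y ∧ G.Adj x p ∧ ∀ z, G.Adj x z → z = y ∨ z = p := by
  simp only [Branching, not_forall, not_exists, not_and, not_not] at hx
  obtain ⟨p, q, hpq⟩ := hx
  obtain ⟨a, b, hab, ha, hb⟩ := hR.two x
  have key : ∀ w, G.Adj x w → w = p ∨ w = q := fun w hw => or_iff_not_imp_left.2 (hpq w hw)
  by_cases hay : a = y
  · refine ⟨b, fun h => hab (hay.trans h.symm), hb, fun z hz => ?_⟩
    rcases eq_or_eq_or_eq_of_pair (key z hz) (key y hxy) (key b hb) with h | h | h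
    exacts [Or.inl h, Or.inr h, absurd (hay.trans h) hab]
  · refine ⟨a, hay, ha, fun z hz => ?_⟩
    rcases eq_or_eq_or_eq_of_pair (key z hz) (key y hxy) (key a ha) with h | h | h
    exacts [Or.inl h, Or.inr h, absurd h.symm hay]

/-- Vertices of degree two are not adjacent. -/
theorem branching_or [Finite V] (hR : Reduced G) {x y : V} (hxy : G.Adj x y) :
    Branching G x ∨ Branching G y := by
  classical
  have := Fintype.ofFinite V
  have : Nonempty V := ⟨x⟩
  by_contra! hcon
  obtain ⟨p, hpy, hxp, hp⟩ := hR.exists_of_not_branching hcon.1 hxy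
  obtain ⟨q, hqx, hyq, hq⟩ := hR.exists_of_not_branching hcon.2 hxy.symm
  have hs := hR.sep p q {x, y} (by simp [hxp.ne', hpy]) (by simp [hyq.ne', hqx]) (by
    rintro u (rfl | rfl) z hz
    · rcases hp z hz with rfl | rfl <;> simp
    · rcases hq z hz with rfl | rfl <;> simp)
  rcases hs with hs | hs
  · exact hxy.ne (hs (by simp) (by simp))
  · have h6 := hR.six_le_card
    have h1 : ((({x, y} ∪ {p, q} : Set V)ᶜ).toFinset).card ≤ 1 :=
      Finset.card_le_one.2 fun a ha b hb => hs (by simpa using ha) (by simpa using hb)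
    have h2 : (Finset.univ : Finset V) ⊆
        ({x, y, p, q} : Finset V) ∪ (({x, y} ∪ {p, q} : Set V)ᶜ).toFinset := by
      intro a _
      simp only [Finset.mem_union, Finset.mem_insert, Finset.mem_singleton, Set.mem_toFinset,
        Set.mem_compl_iff, Set.mem_union, Set.mem_insert_iff, Set.mem_singleton_iff]
      tauto
    have h3 := Finset.card_le_card h2
    have h4 := Finset.card_union_le ({x, y, p, q} : Finset V)
      (({x, y} ∪ {p, q} : Set V)ᶜ).toFinset
    have h5 : ({x, y, p, q} : Finset V).card ≤ 4 := Finset.card_le_four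
    rw [Finset.card_univ] at h3
    omega

/-- A component of the complement of a cycle with at most two attachments is a single vertex. -/
theorem eq_of_mem_compIn (hR : Reduced G) (h : IsCyc G m c) {z p q : V}
    (hp : p ∈ Set.range c) (hq : q ∈ Set.range c)
    (hpq : ∀ x ∈ Set.range c, Touch G (compIn G (Set.range c)ᶜ z) {x} → x = p ∨ x = q)
    (hz : z ∉ Set.range c) : (∀ y ∈ compIn G (Set.range c)ᶜ z, y = z) ∧
      ∀ y, G.Adj z y → y = p ∨ y = q := by
  have hm := hR.girth m c h
  have hself := mem_compIn_self (G := G) (S := (Set.range c)ᶜ) hz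
  set Q := compIn G (Set.range c)ᶜ z with hQ
  have hQc : Q ⊆ (Set.range c)ᶜ := compIn_subset
  have hsub : ∀ y ∈ Q, y = z := by
    rcases hR.sep p q Q (fun h' => hQc h' hp) (fun h' => hQc h' hq) (fun x hx y hxy => by
      by_cases hy : y ∈ Set.range c
      · exact Or.inr (hpq y hy ⟨x, hx, y, rfl, hxy⟩)
      · exact Or.inl (mem_compIn_of_adj hx hxy hy)) with hs | hs
    · exact fun y hy => hs hy hself
    · exfalso
      have key : ∀ i j, i < j → j < 4 → (c i = p ∨ c i = q) ∨ c j = p ∨ c j = q := by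
        intro i j hij hj
        by_contra! hcon
        refine h.ne_of_lt hij (by omega) (hs ?_ ?_)
        · rintro (h1 | h1 | h1)
          exacts [hQc h1 ⟨_, rfl⟩, hcon.1.1 h1, hcon.1.2 h1]
        · rintro (h1 | h1 | h1)
          exacts [hQc h1 ⟨_, rfl⟩, hcon.2.1 h1, hcon.2.2 h1]
      have three : ∀ i j l, i < j → j < l → l < 4 →
          ¬ ((c i = p ∨ c i = q) ∧ (c j = p ∨ c j = q) ∧ (c l = p ∨ c l = q)) := by
        rintro i j l hij hjl hl ⟨h1, h2, h3⟩
        rcases eq_or_eq_or_eq_of_pair h1 h2 h3 with h4 | h4 | h4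
        exacts [h.ne_of_lt hij (by omega) h4, h.ne_of_lt (hij.trans hjl) (by omega) h4,
          h.ne_of_lt hjl (by omega) h4]
      have key' : ∀ i j, i < j → j < 4 → ¬ (c i = p ∨ c i = q) → c j = p ∨ c j = q :=
        fun i j hij hj hi => (key i j hij hj).resolve_left hi
      have k01 := key' 0 1 (by omega) (by omega)
      have k02 := key' 0 2 (by omega) (by omega)
      have k03 := key' 0 3 (by omega) (by omega)
      by_cases h0 : c 0 = p ∨ c 0 = q
      · by_cases h1 : c 1 = p ∨ c 1 = q
        · rcases key 2 3 (by omega) (by omega) with h2 | h2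
          exacts [three 0 1 2 (by omega) (by omega) (by omega) ⟨h0, h1, h2⟩,
            three 0 1 3 (by omega) (by omega) (by omega) ⟨h0, h1, h2⟩]
        · exact three 0 2 3 (by omega) (by omega) (by omega) ⟨h0,
            key' 1 2 (by omega) (by omega) h1, key' 1 3 (by omega) (by omega) h1⟩
      · exact three 1 2 3 (by omega) (by omega) (by omega) ⟨k01 h0, k02 h0, k03 h0⟩
  refine ⟨hsub, fun y hy => ?_⟩
  by_cases hyc : y ∈ Set.range c
  · exact hpq y hyc ⟨z, hself, y, rfl, hy⟩
  · exact absurd (hsub y (mem_compIn_of_adj hself hy hyc)).symm hy.ne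

/-- The component of a vertex of degree at least three has three attachments. -/
theorem exists_attachment (hR : Reduced G) (h : IsCyc G m c) {v : V} (hv : Branching G v)
    (hvc : v ∉ Set.range c) {p q : V} (hp : p ∈ Set.range c) (hq : q ∈ Set.range c) :
    ∃ x ∈ Set.range c, Touch G (compIn G (Set.range c)ᶜ v) {x} ∧ x ≠ p ∧ x ≠ q := by
  by_contra! hcon
  obtain ⟨y, hy, h1, h2⟩ := hv p q
  rcases (hR.eq_of_mem_compIn h hp hq
    (fun x hx ht => or_iff_not_imp_left.2 (hcon x hx ht)) hvc).2 y hy with h3 | h3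
  exacts [h1 h3, h2 h3]

/-- Every component of the complement of a cycle has two attachments. -/
theorem exists_attachment_ne (hR : Reduced G) (h : IsCyc G m c) {v : V}
    (hvc : v ∉ Set.range c) {p : V} (hp : p ∈ Set.range c) :
    ∃ x ∈ Set.range c, Touch G (compIn G (Set.range c)ᶜ v) {x} ∧ x ≠ p := by
  by_contra! hcon
  obtain ⟨a, b, hab, ha, hb⟩ := hR.two v
  have := (hR.eq_of_mem_compIn h hp hp (fun x hx ht => Or.inl (hcon x hx ht)) hvc).2
  exact hab ((or_self_iff.1 (this a ha)).trans (or_self_iff.1 (this b hb)).symm)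

end Reduced

theorem SetConn.linkedIn_of_touch {Q : Set V} (hQ : SetConn G Q) {a b : V}
    (ha : Touch G Q {a}) (hb : Touch G Q {b}) : LinkedIn G (Q ∪ {a, b}) a b := by
  obtain ⟨x, hx, _, rfl, hxa⟩ := ha
  obtain ⟨y, hy, _, rfl, hyb⟩ := hb
  refine (LinkedIn.of_adj hxa.symm (by simp) (Or.inl hx)).trans ?_
  exact ((hQ x hx y hy).mono Set.subset_union_left).snoc hyb (by simp)

end Reduced

section Stuck

variable {V : Type} {G : SimpleGraph V} {M : Submodule (ZMod 2) (Sym2 V → ZMod 2)} {v : V}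
  {m : ℕ} {c : ℕ → V}

/-- A neighbor of the `i`-th vertex of `c` is joined to `v` off `c`. -/
def Att (G : SimpleGraph V) (c : ℕ → V) (v : V) (i : ℕ) : Prop :=
  Touch G (compIn G (Set.range c)ᶜ v) {c i}

/-- The cycle `c` avoids `v` and its chain is not in `M`, in contrast to all closed walks avoiding
the component of `v` and one of its attachments. -/
structure Stuck (G : SimpleGraph V) (M : Submodule (ZMod 2) (Sym2 V → ZMod 2)) (v : V) (m : ℕ)
    (c : ℕ → V) : Prop where
  cyc : IsCyc G m c
  notMem_range : v ∉ Set.range c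
  closed : ∀ i, Att G c v i → ClosedIn G M (compIn G (Set.range c)ᶜ v ∪ {c i})ᶜ
  notMem : arcChain c 0 m ∉ M

namespace Stuck

theorem shift (h : Stuck G M v m c) (k : ℕ) : Stuck G M v m (fun i => c (i + k)) where
  cyc := h.cyc.shift k
  notMem_range := by rw [h.cyc.range_shift]; exact h.notMem_range
  closed i hi := by
    rw [Att, h.cyc.range_shift] at hi
    rw [h.cyc.range_shift]
    exact h.closed _ hi
  notMem := by rw [h.cyc.arcChain_shift]; exact h.notMem

theorem att_shift (h : Stuck G M v m c) (k i : ℕ) :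
    Att G (fun i => c (i + k)) v i ↔ Att G c v (i + k) := by
  rw [Att, Att, h.cyc.range_shift]

theorem att_add (h : Stuck G M v m c) (i : ℕ) : Att G c v (i + m) ↔ Att G c v i := by
  rw [Att, Att, h.cyc.periodic]

theorem subset_compl (h : Stuck G M v m c) {i j x : ℕ} (hx : x < i + m) (hj : j < x + m)
    (hxij : x < i ∨ j < x) {S : Set V}
    (hS : ∀ z ∈ S, z ∉ compIn G (Set.range c)ᶜ v) (hSx : c x ∉ S) :
    c '' Set.Icc i j ∪ S ⊆ (compIn G (Set.range c)ᶜ v ∪ {c x})ᶜ := by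
  rintro _ (⟨l, ⟨hl, hl'⟩, rfl⟩ | hz) (hK | he)
  · exact compIn_subset hK ⟨l, rfl⟩
  · rcases hxij with h1 | h1
    · exact h.cyc.ne_of_lt (show x < l by omega) (by omega) he.symm
    · exact h.cyc.ne_of_lt (show l < x by omega) (by omega) he
  · exact hS _ hz hK
  · exact hSx (he ▸ hz)

theorem not_split (h : Stuck G M v m c) {i j x y : ℕ} (hix : i < x) (hxj : x < j) (hjy : j < y)
    (hy : y < i + m) {S : Set V} (hl : LinkedIn G S (c i) (c j))
    (hS : ∀ z ∈ S, z ∉ compIn G (Set.range c)ᶜ v)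
    (hSc : ∀ z ∈ S, z ∈ Set.range c → z = c i ∨ z = c j) (hx : Att G c v x) (hy' : Att G c v y) :
    False := by
  have ne : ∀ l, l ≠ i → l ≠ j → i < l → l < i + m → c l ∉ S := by
    intro l hli hlj hl hl' hmem
    rcases hSc _ hmem ⟨l, rfl⟩ with h1 | h1
    · exact hli (h.cyc.eq_of_window (k := i) (by omega) (by omega) (by omega) (by omega) h1)
    · exact hlj (h.cyc.eq_of_window (k := i) (by omega) (by omega) (by omega) (by omega) h1)
  exact h.notMem (h.cyc.arcChain_mem_of_link (by omega) (by omega) hl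
    ((h.closed y hy').anti (h.subset_compl (by omega) (by omega) (by omega) hS
      (ne y (by omega) (by omega) (by omega) (by omega))))
    ((h.closed x hx).anti (h.subset_compl (by omega) (by omega) (by omega) hS
      (ne x (by omega) (by omega) (by omega) (by omega)))))

theorem not_tripod (h : Stuck G M v m c) {i j l : ℕ} (hij : i < j) (hjl : j < l) (hl : l < i + m)
    {Q : Set V} (hQ : SetConn G Q) (hQK : ∀ z ∈ Q, z ∉ compIn G (Set.range c)ᶜ v)
    (hQc : ∀ z ∈ Q, z ∉ Set.range c) (hi : Touch G Q {c i}) (hj : Touch G Q {c j})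
    (hl' : Touch G Q {c l}) (hAi : Att G c v i) (hAj : Att G c v j) (hAl : Att G c v l) :
    False := by
  obtain ⟨y, hy, _, rfl, hyi⟩ := hi
  obtain ⟨y', hy', _, rfl, hyj⟩ := hj
  obtain ⟨y'', hy'', _, rfl, hyl⟩ := hl'
  have link : ∀ {u l}, u ∈ Q → G.Adj u (c l) → LinkedIn G (Q ∪ {c l}) y (c l) := fun hu hul =>
    ((hQ y hy _ hu).mono Set.subset_union_left).snoc hul (by simp)
  have sub : ∀ x, c x ∉ Q := fun x hx => hQc _ hx ⟨x, rfl⟩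
  refine h.notMem (h.cyc.arcChain_mem_of_tripod hij.le hjl.le hl.le (link hy hyi) (link hy' hyj)
    (link hy'' hyl) ((h.closed l hAl).anti ?_) ((h.closed (i + m) ((h.att_add i).2 hAi)).anti ?_)
    ((h.closed j hAj).anti ?_))
  · exact h.subset_compl (by omega) (by omega) (by omega) hQK (sub _)
  · exact h.subset_compl (by omega) (by omega) (by omega) hQK (sub _)
  · exact h.subset_compl (by omega) (by omega) (by omega) hQK (sub _)

theorem subsingleton_of_gap (h : Stuck G M v m c) (hR : Reduced G) (hv : Branching G v) {k : ℕ}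
    (hk : 0 < k) (hgap : ∀ x, 0 < x → x < k → ¬ Att G c v x) {Q : Set V}
    (hQ : SetConn G Q) (hQK : ∀ z ∈ Q, z ∉ compIn G (Set.range c)ᶜ v)
    (hQc : ∀ z ∈ Q, z ∉ Set.range c) (hQQ : ∀ z ∈ Q, ∀ y, G.Adj z y → y ∉ Set.range c → y ∈ Q)
    (h0 : Q.Nonempty → Touch G Q {c 0}) (hk' : Q.Nonempty → Touch G Q {c k}) :
    (c '' Set.Ioo 0 k ∪ Q).Subsingleton := by
  classical
  have hc := h.cyc
  have hm := hc.three_le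
  set K := compIn G (Set.range c)ᶜ v with hK
  have hKc : ∀ z ∈ K, z ∉ Set.range c := fun z hz => compIn_subset hz
  have hper : ∀ x, c (x + m) = c x := hc.periodic
  have att_of : ∀ p q, p ∈ Set.range c → q ∈ Set.range c →
      ∃ x, k ≤ x ∧ x ≤ m ∧ Att G c v x ∧ c x ≠ p ∧ c x ≠ q := by
    intro p q hp hq
    obtain ⟨_, hx, ht, h1, h2⟩ := hR.exists_attachment hc hv h.notMem_range hp hq
    obtain ⟨x, hx1, hx2, rfl⟩ := hc.exists_window hx 1
    refine ⟨x, ?_, by omega, ht, h1, h2⟩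
    by_contra hcon
    exact hgap x hx1 (by omega) ht
  have hex : ∃ x, k ≤ x ∧ x ≤ m ∧ Att G c v x := by
    obtain ⟨x, h1, h2, h3, _⟩ := att_of (c 0) (c 0) ⟨0, rfl⟩ ⟨0, rfl⟩
    exact ⟨x, h1, h2, h3⟩
  obtain ⟨lo, ⟨hlo1, hlo2, hlo3⟩, hlo⟩ : ∃ lo, (k ≤ lo ∧ lo ≤ m ∧ Att G c v lo) ∧
      ∀ x, k ≤ x → x < lo → ¬ Att G c v x :=
    ⟨Nat.find hex, Nat.find_spec hex, fun x h1 h2 h3 =>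
      Nat.find_min hex h2 ⟨h1, h2.le.trans (Nat.find_spec hex).2.1, h3⟩⟩
  obtain ⟨hi, hhi1, hhi2, hhi3, hhi⟩ : ∃ hi, k ≤ hi ∧ hi ≤ m ∧ Att G c v hi ∧
      ∀ x, hi < x → x ≤ m → ¬ Att G c v x := by
    have hspec := Nat.findGreatest_spec (P := fun x => k ≤ x ∧ Att G c v x) hlo2 ⟨hlo1, hlo3⟩
    refine ⟨_, hspec.1, Nat.findGreatest_le _, hspec.2, fun x h1 h2 h3 => ?_⟩
    exact Nat.findGreatest_is_greatest h1 h2 ⟨hspec.1.trans h1.le, h3⟩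
  obtain ⟨t, ht1, ht2, ht3, htlo, hthi⟩ := att_of (c lo) (c hi) ⟨lo, rfl⟩ ⟨hi, rfl⟩
  have hlot : lo < t := by
    rcases lt_trichotomy t lo with h1 | rfl | h1
    exacts [absurd ht3 (hlo t ht1 h1), absurd rfl htlo, h1]
  have hthi' : t < hi := by
    rcases lt_trichotomy t hi with h1 | rfl | h1
    exacts [h1, absurd rfl hthi, absurd ht3 (hhi t h1 ht2)]
  have F1 : ∀ g, hi < g → g < m + lo → ¬ Att G c v g := by
    intro g h1 h2 h3
    rcases Nat.lt_or_ge m g with h4 | h4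
    · obtain ⟨g, rfl⟩ : ∃ g', g = g' + m := ⟨g - m, by omega⟩
      rw [h.att_add] at h3
      rcases Nat.lt_or_ge g k with h5 | h5
      · exact hgap g (by omega) h5 h3
      · exact hlo g h5 (by omega) h3
    · exact hhi g h1 h4 h3
  have F2 : ∀ g d S, hi < g → g < m + lo → LinkedIn G S (c g) (c d) → (∀ z ∈ S, z ∉ K) →
      (∀ z ∈ S, z ∈ Set.range c → z = c g ∨ z = c d) →
      c d ∈ c '' Set.Ioo hi (m + lo) ∨ c d = c lo ∨ c d = c hi := by
    intro g d S hg hg' hl hS hSc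
    obtain ⟨d', hd1, hd2, hd⟩ := hc.exists_window (Set.mem_range_self d) hi
    rw [← hd] at hl hSc ⊢
    rcases lt_trichotomy d' (m + lo) with h1 | rfl | h1
    · rcases Nat.eq_or_lt_of_le hd1 with rfl | h2
      exacts [Or.inr (Or.inr rfl), Or.inl ⟨d', ⟨h2, h1⟩, rfl⟩]
    · exact Or.inr (Or.inl (by rw [add_comm, hper]))
    · exact (h.not_split hg' h1 hd2 (by omega) hl hS hSc
        (by rw [add_comm, h.att_add]; exact hlo3) (by rw [h.att_add]; exact hhi3)).elim
  have linkQ : ∀ {a b Q}, SetConn G Q → (∀ z ∈ Q, z ∉ K) → (∀ z ∈ Q, z ∉ Set.range c) →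
      Touch G Q {c a} → Touch G Q {c b} → LinkedIn G (Q ∪ {c a, c b}) (c a) (c b) ∧
      (∀ z ∈ Q ∪ {c a, c b}, z ∉ K) ∧
      (∀ z ∈ Q ∪ {c a, c b}, z ∈ Set.range c → z = c a ∨ z = c b) := by
    intro a b Q hQ hQK hQc ha hb
    refine ⟨hQ.linkedIn_of_touch ha hb, ?_, ?_⟩
    · rintro z (hz | rfl | rfl)
      exacts [hQK z hz, fun hz => hKc _ hz ⟨_, rfl⟩, fun hz => hKc _ hz ⟨_, rfl⟩]
    · rintro z (hz | hz) hzc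
      exacts [absurd hzc (hQc z hz), hz]
  have F3 : ∀ d, Touch G Q {c d} → c d ∈ c '' Set.Ioo hi (m + lo) ∨ c d = c lo ∨ c d = c hi := by
    intro d hd
    obtain ⟨u, hu, -⟩ := id hd
    have h0 := h0 ⟨u, hu⟩
    have hk' := hk' ⟨u, hu⟩
    have hcm : c m = c 0 := by simpa using hper 0
    rw [← hcm] at h0
    by_cases hhm : hi < m
    · obtain ⟨l1, l2, l3⟩ := linkQ hQ hQK hQc h0 hd
      exact F2 m d _ hhm (by omega) l1 l2 l3
    by_cases hlk : k < lo
    · obtain ⟨l1, l2, l3⟩ := linkQ hQ hQK hQc (a := k + m) (by rwa [hper]) hd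
      exact F2 (k + m) d _ (by omega) (by omega) l1 l2 l3
    obtain rfl : m = hi := by omega
    obtain rfl : k = lo := by omega
    obtain ⟨d', hd1, hd2, hde⟩ := hc.exists_window (Set.mem_range_self d) k
    rw [← hde] at hd ⊢
    clear hde
    rename' d' => d
    by_cases hdm : m ≤ d
    · rcases Nat.eq_or_lt_of_le hdm with rfl | h2
      exacts [Or.inr (Or.inr rfl), Or.inl ⟨d, ⟨h2, by omega⟩, rfl⟩]
    rcases Nat.eq_or_lt_of_le hd1 with rfl | hkd
    · exact Or.inr (Or.inl rfl)
    exfalso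
    rcases lt_trichotomy t d with h1 | rfl | h1
    · obtain ⟨l1, l2, l3⟩ := linkQ hQ hQK hQc hk' hd
      exact h.not_split hlot h1 (by omega) (by omega) l1 l2 l3 ht3 hhi3
    · exact h.not_tripod hlot hthi' (by omega) hQ hQK hQc hk' hd h0 hlo3 ht3 hhi3
    · obtain ⟨l1, l2, l3⟩ := linkQ hQ hQK hQc hd h0
      exact h.not_split h1 hthi' (show m < k + m by omega) (by omega) l1 l2 l3 ht3
        (by rw [h.att_add]; exact hlo3)
  have gap_ne : ∀ g ∈ Set.Ioo hi (m + lo), c g ≠ c lo ∧ c g ≠ c hi ∧ c g ≠ c t := by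
    rintro g ⟨h1, h2⟩
    refine ⟨?_, (hc.ne_of_lt h1 (by omega)).symm, ?_⟩
    · rw [← hper lo]
      exact hc.ne_of_lt (by omega) (by omega)
    · rw [← hper t]
      exact hc.ne_of_lt (by omega) (by omega)
  have notMemK : ∀ z, z ∉ Set.range c → z ∉ K → ∀ y ∈ compIn G (Set.range c)ᶜ z, y ∉ K := by
    intro z hz hzK y hy hyK
    have : compIn G (Set.range c)ᶜ z = K := (compIn_eq_of_mem hy).symm.trans (compIn_eq_of_mem hyK)
    exact hzK (this ▸ mem_compIn_self hz)
  set Z : Set V := {z | z ∉ Set.range c ∧ z ∉ K ∧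
    ∃ g ∈ Set.Ioo hi (m + lo), Touch G (compIn G (Set.range c)ᶜ z) {c g}} with hZ
  have hp : ∀ i, (∀ g ∈ Set.Ioo hi (m + lo), c g ≠ c i) →
      c i ∉ c '' Set.Ioo hi (m + lo) ∪ Q ∪ Z := by
    rintro i hi' ((⟨g, hg, he⟩ | hq) | hz)
    exacts [hi' g hg he, hQc _ hq ⟨i, rfl⟩, hz.1 ⟨i, rfl⟩]
  have hsep := hR.sep (c lo) (c hi) (c '' Set.Ioo hi (m + lo) ∪ Q ∪ Z)
    (hp lo fun g hg => (gap_ne g hg).1) (hp hi fun g hg => (gap_ne g hg).2.1) (by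
      rintro x ((⟨g, hg, rfl⟩ | hxQ) | ⟨hxc, hxK, g, hg, hxt⟩) y hxy
      · by_cases hyc : y ∈ Set.range c
        · obtain ⟨d, rfl⟩ := hyc
          have := F2 g d {c g, c d} hg.1 hg.2 (LinkedIn.of_adj hxy (by simp) (by simp))
            (by rintro z (rfl | rfl) hz <;> exact hKc _ hz ⟨_, rfl⟩) (fun z hz _ => hz)
          exact this.imp_left fun h => Or.inl (Or.inl h)
        · have hyK : y ∉ K := fun hyK => F1 g hg.1 hg.2 ⟨y, hyK, _, rfl, hxy.symm⟩
          exact Or.inl (Or.inr ⟨hyc, hyK, g, hg, y, mem_compIn_self hyc, _, rfl, hxy.symm⟩)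
      · by_cases hyc : y ∈ Set.range c
        · obtain ⟨d, rfl⟩ := hyc
          exact (F3 d ⟨x, hxQ, _, rfl, hxy⟩).imp_left fun h => Or.inl (Or.inl h)
        · exact Or.inl (Or.inl (Or.inr (hQQ x hxQ y hxy hyc)))
      · have hself := mem_compIn_self (G := G) (S := (Set.range c)ᶜ) hxc
        by_cases hyc : y ∈ Set.range c
        · obtain ⟨d, rfl⟩ := hyc
          obtain ⟨l1, l2, l3⟩ := linkQ setConn_compIn (notMemK x hxc hxK)
            (fun z hz => compIn_subset hz) hxt ⟨x, hself, _, rfl, hxy⟩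
          exact (F2 g d _ hg.1 hg.2 l1 l2 l3).imp_left fun h => Or.inl (Or.inl h)
        · have hy := mem_compIn_of_adj hself hxy hyc
          refine Or.inl (Or.inr ⟨hyc, notMemK x hxc hxK y hy, g, hg, ?_⟩)
          rwa [compIn_eq_of_mem hy])
  have hvK : v ∈ K := mem_compIn_self h.notMem_range
  rcases hsep with hs | hs
  · refine hs.anti ?_
    rintro _ (⟨g, ⟨h1, h2⟩, rfl⟩ | hq)
    · exact Or.inl (Or.inl ⟨g + m, ⟨by omega, by omega⟩, hper g⟩)
    · exact Or.inl (Or.inr hq)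
  · exfalso
    refine h.notMem_range ⟨t, hs ?_ ?_⟩
    · rintro (h1 | h1 | h1)
      exacts [hp t (fun g hg => (gap_ne g hg).2.2) h1, htlo h1, hthi h1]
    · rintro (((⟨g, hg, h1⟩ | h1) | h1) | h1 | h1)
      exacts [h.notMem_range ⟨g, h1⟩, hQK v h1 hvK, h1.2.1 hvK, h.notMem_range ⟨lo, h1.symm⟩,
        h.notMem_range ⟨hi, h1.symm⟩]

theorem exists_att_of_chord (h : Stuck G M v m c) (hR : Reduced G) (hv : Branching G v) {k : ℕ}
    (hk : 2 ≤ k) (hkm : k < m) (hadj : G.Adj (c k) (c 0)) : ∃ x, 0 < x ∧ x < k ∧ Att G c v x := by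
  by_contra! hcon
  have h5 := hR.add_five_le_of_chord h.cyc (i := 0) (by omega) (by omega) hadj
  have := h.subsingleton_of_gap hR hv (by omega) hcon (Q := ∅)
    (fun x hx => hx.elim) (by simp) (by simp) (by simp) (by simp) (by simp)
  exact h.cyc.ne_of_lt (show 1 < 2 by omega) (by omega) (this
    (Or.inl ⟨1, ⟨by omega, by omega⟩, rfl⟩) (Or.inl ⟨2, ⟨by omega, by omega⟩, rfl⟩))

theorem exists_att_of_ear (h : Stuck G M v m c) (hR : Reduced G) (hv : Branching G v) {k : ℕ}
    (hk : 0 < k) (hkm : k < m) {z : V} (hz : z ∉ Set.range c)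
    (hzK : ∀ y ∈ compIn G (Set.range c)ᶜ z, y ∉ compIn G (Set.range c)ᶜ v)
    (h0 : Touch G (compIn G (Set.range c)ᶜ z) {c 0})
    (hk' : Touch G (compIn G (Set.range c)ᶜ z) {c k}) : ∃ x, 0 < x ∧ x < k ∧ Att G c v x := by
  by_contra! hcon
  have hs := h.subsingleton_of_gap hR hv hk hcon setConn_compIn hzK
    (fun z hz => compIn_subset hz) (fun z hz y hzy hy => mem_compIn_of_adj hz hzy hy)
    (fun _ => h0) (fun _ => hk')
  have hself : z ∈ compIn G (Set.range c)ᶜ z := mem_compIn_self hz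
  have hk1 : k = 1 := by
    by_contra hk1
    exact hz ⟨1, hs (Or.inl ⟨1, ⟨by omega, by omega⟩, rfl⟩) (Or.inr hself)⟩
  subst hk1
  obtain ⟨x, hx, _, rfl, hx0⟩ := h0
  obtain ⟨y, hy, _, rfl, hy1⟩ := hk'
  obtain rfl : x = z := hs (Or.inr hx) (Or.inr hself)
  obtain rfl : y = x := hs (Or.inr hy) (Or.inr hself)
  have := hR.add_four_le_of_ear h.cyc (i := 0) (k := 1) (by omega) (by omega) hz hy1.symm hx0
  omega

theorem not_adj (h : Stuck G M v m c) (hR : Reduced G) (hv : Branching G v) {k : ℕ}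
    (hk : 2 ≤ k) (hkm : k + 2 ≤ m) : ¬ G.Adj (c k) (c 0) := by
  intro hadj
  have hcm : c m = c 0 := by simpa using h.cyc.periodic 0
  obtain ⟨x, hx0, hxk, hx⟩ := h.exists_att_of_chord hR hv hk (by omega) hadj
  obtain ⟨y, hy0, hyk, hy⟩ := (h.shift k).exists_att_of_chord hR hv (k := m - k) (by omega)
    (by omega) (by simpa [Nat.sub_add_cancel (show k ≤ m by omega), hcm] using hadj.symm)
  refine h.not_split hx0 hxk (show k < y + k by omega) (by omega) (S := {c 0, c k})
    (LinkedIn.of_adj hadj.symm (by simp) (by simp)) ?_ (fun z hz _ => hz) hx ((h.att_shift k y).1 hy)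
  rintro z (rfl | rfl) hz <;> exact compIn_subset hz ⟨_, rfl⟩

theorem not_touch (h : Stuck G M v m c) (hR : Reduced G) (hv : Branching G v) {k : ℕ}
    (hk : 0 < k) (hkm : k < m) {z : V} (hz : z ∉ Set.range c)
    (hzK : z ∉ compIn G (Set.range c)ᶜ v) (h0 : Touch G (compIn G (Set.range c)ᶜ z) {c 0})
    (hk' : Touch G (compIn G (Set.range c)ᶜ z) {c k}) : False := by
  have hcm : c m = c 0 := by simpa using h.cyc.periodic 0
  have hK : ∀ y ∈ compIn G (Set.range c)ᶜ z, y ∉ compIn G (Set.range c)ᶜ v := by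
    intro y hy hyK
    have := (compIn_eq_of_mem hy).symm.trans (compIn_eq_of_mem hyK)
    exact hzK (this ▸ mem_compIn_self hz)
  obtain ⟨x, hx0, hxk, hx⟩ := h.exists_att_of_ear hR hv hk hkm hz hK h0 hk'
  obtain ⟨y, hy0, hyk, hy⟩ := (h.shift k).exists_att_of_ear hR hv (k := m - k) (z := z) (by omega)
    (by omega) (by rwa [h.cyc.range_shift]) (by rwa [h.cyc.range_shift])
    (by rwa [h.cyc.range_shift, zero_add])
    (by rwa [h.cyc.range_shift, Nat.sub_add_cancel hkm.le, hcm])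
  refine h.not_split hx0 hxk (show k < y + k by omega) (by omega)
    (setConn_compIn.linkedIn_of_touch h0 hk') ?_ ?_ hx ((h.att_shift k y).1 hy)
  · rintro w (hw | rfl | rfl) hwK
    exacts [hK w hw hwK, compIn_subset hwK ⟨_, rfl⟩, compIn_subset hwK ⟨_, rfl⟩]
  · rintro w (hw | hw) hwc
    exacts [absurd hwc (compIn_subset hw), hw]

theorem isPeripheral (h : Stuck G M v m c) (hR : Reduced G) (hv : Branching G v) :
    IsPeripheral G m c := by
  refine ⟨h.cyc, fun i j hij => ?_, SetConn.of_base v fun z hz => ?_⟩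
  · by_contra! hcon
    obtain ⟨j', h1, h2, hj⟩ := h.cyc.exists_window (Set.mem_range_self j) i
    obtain ⟨k, rfl⟩ : ∃ k, j' = k + i := ⟨j' - i, by omega⟩
    have hj1 : c (k + i + 1) = c (j + 1) := by
      rw [h.cyc.eq_iff] at hj ⊢
      exact Nat.ModEq.add_right 1 hj
    rw [← hj, ← hj1] at hcon
    rw [← hj] at hij
    have hk0 : k ≠ 0 := by rintro rfl; exact hij.ne (by simp)
    have hk1 : k ≠ 1 := by rintro rfl; exact hcon.1 (by rw [add_comm])
    have hkm : k + 1 ≠ m := by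
      intro hkm
      rw [add_right_comm, hkm, add_comm m, h.cyc.periodic] at hcon
      exact hcon.2 rfl
    exact (h.shift i).not_adj hR hv (k := k) (by omega) (by omega) (by simpa using hij.symm)
  · by_contra hzK
    obtain ⟨_, ⟨i, rfl⟩, hi, -⟩ := hR.exists_attachment_ne h.cyc hz ⟨0, rfl⟩
    obtain ⟨_, hx, hx', hne⟩ := hR.exists_attachment_ne h.cyc hz ⟨i, rfl⟩
    obtain ⟨j, h1, h2, rfl⟩ := h.cyc.exists_window hx i
    obtain ⟨k, rfl⟩ : ∃ k, j = k + i := ⟨j - i, by omega⟩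
    have hk0 : k ≠ 0 := by rintro rfl; exact hne (by simp)
    exact (h.shift i).not_touch hR hv (k := k) (by omega) (by omega)
      (by rwa [h.cyc.range_shift]) (by rwa [h.cyc.range_shift]) (by rwa [h.cyc.range_shift, zero_add])
      (by rwa [h.cyc.range_shift])

end Stuck

/-- If `M` contains the chains of the peripheral cycles avoiding a vertex of degree at least three,
then it contains the chains of all cycles avoiding this vertex. -/
theorem Reduced.arcChain_mem_of_avoid [Finite V] (hR : Reduced G) (hv : Branching G v)
    (hM : ∀ m c, IsPeripheral G m c → v ∉ Set.range c → arcChain c 0 m ∈ M) :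
    ∀ m c, IsCyc G m c → v ∉ Set.range c → arcChain c 0 m ∈ M := by
  have key : ∀ n m c, IsCyc G m c → v ∉ Set.range c →
      (compIn G (Set.range c)ᶜ v)ᶜ.ncard ≤ n → arcChain c 0 m ∈ M := by
    intro n
    induction n with
    | zero =>
      intro m c h hvc hn
      rw [Nat.le_zero, Set.ncard_eq_zero] at hn
      have : c 0 ∈ (compIn G (Set.range c)ᶜ v)ᶜ := fun h0 => compIn_subset h0 ⟨0, rfl⟩
      rw [hn] at this
      exact this.elim
    | succ n ih =>
      intro m c h hvc hn
      by_contra hcon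
      have hs : Stuck G M v m c := by
        refine ⟨h, hvc, fun i hi => ClosedIn.of_cycles fun l d hd hdK => ?_, hcon⟩
        have hvd : v ∉ Set.range d := fun hv' => hdK hv' (Or.inl (mem_compIn_self hvc))
        have hsub : compIn G (Set.range c)ᶜ v ⊆ compIn G (Set.range d)ᶜ v := by
          intro z hz
          exact hz.in_compIn.mono fun u hu hud => hdK hud (Or.inl hu)
        have hci : c i ∈ compIn G (Set.range d)ᶜ v := by
          obtain ⟨u, hu, _, rfl, hui⟩ := hi
          exact mem_compIn_of_adj (hsub hu) hui fun hud => hdK hud (Or.inr rfl)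
        refine ih l d hd hvd (Nat.le_of_lt_succ (lt_of_lt_of_le (Set.ncard_lt_ncard ?_) hn))
        refine ⟨Set.compl_subset_compl.2 hsub, fun hcon => ?_⟩
        exact hcon (show c i ∈ _ from fun h0 => compIn_subset h0 ⟨i, rfl⟩) hci
      exact hcon (hM m c (hs.isPeripheral hR hv) hvc)
  exact fun m c h hvc => key _ m c h hvc le_rfl

end Stuck

section Span

variable {V : Type} {G : SimpleGraph V} {M : Submodule (ZMod 2) (Sym2 V → ZMod 2)}
  {m : ℕ} {c : ℕ → V}

namespace Reduced

theorem arcChain_mem_of_long_link [Finite V] (hR : Reduced G) (h : IsCyc G m c)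
    (hM : ∀ a ∈ Set.range c, Branching G a → ClosedIn G M {a}ᶜ) {k : ℕ} (hk : 3 ≤ k)
    (hkm : k + 3 ≤ m) {S : Set V} (hS : LinkedIn G S (c 0) (c k))
    (hSc : ∀ z ∈ S, z ∈ Set.range c → z = c 0 ∨ z = c k) : arcChain c 0 m ∈ M := by
  have pick : ∀ i, ∃ x, i + 1 ≤ x ∧ x ≤ i + 2 ∧ Branching G (c x) := by
    intro i
    rcases hR.branching_or (h.adj (i + 1)) with hb | hb
    exacts [⟨_, le_rfl, by omega, hb⟩, ⟨_, by omega, le_rfl, hb⟩]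
  obtain ⟨x, hx1, hx2, hx⟩ := pick 0
  obtain ⟨y, hy1, hy2, hy⟩ := pick k
  have notMem : ∀ l, 0 < l → l < m → l ≠ k → c l ∉ S := by
    intro l h0 hlm hlk hl
    rcases hSc _ hl ⟨l, rfl⟩ with he | he
    · exact h.ne_of_lt h0 (by omega) he.symm
    · exact hlk (h.inj _ _ hlm (by omega) he)
  refine h.arcChain_mem_of_link (Nat.zero_le k) (by omega) hS
    ((hM (c y) ⟨y, rfl⟩ hy).anti ?_) ((hM (c x) ⟨x, rfl⟩ hx).anti ?_)
  · rintro _ (⟨l, ⟨h1, h2⟩, rfl⟩ | hz) he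
    exacts [h.ne_of_lt (show l < y by omega) (by omega) he,
      notMem y (by omega) (by omega) (by omega) (he ▸ hz)]
  · rintro _ (⟨l, ⟨h1, h2⟩, rfl⟩ | hz) he
    exacts [h.ne_of_lt (show x < l by omega) (by omega) he.symm,
      notMem x (by omega) (by omega) (by omega) (he ▸ hz)]

theorem arcChain_mem_of_three (h : IsCyc G m c)
    (hM : ∀ a ∈ Set.range c, Branching G a → ClosedIn G M {a}ᶜ) {z x y u : V}
    (hx : x ∈ Set.range c) (hy : y ∈ Set.range c) (hu : u ∈ Set.range c) (hxy : x ≠ y)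
    (hxu : x ≠ u) (hyu : y ≠ u) (tx : Touch G (compIn G (Set.range c)ᶜ z) {x})
    (ty : Touch G (compIn G (Set.range c)ᶜ z) {y}) (tu : Touch G (compIn G (Set.range c)ᶜ z) {u}) :
    arcChain c 0 m ∈ M := by
  have key : ∀ i j l, 0 < i → i < j → j < l → l < i + m →
      Touch G (compIn G (Set.range c)ᶜ z) {c i} → Touch G (compIn G (Set.range c)ᶜ z) {c j} →
      Touch G (compIn G (Set.range c)ᶜ z) {c l} → arcChain c 0 m ∈ M := by
    intro i j l hi hij hjl hl ti tj tl
    set Q := compIn G (Set.range c)ᶜ z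
    have hQc : ∀ e, c e ∉ Q := fun e he => compIn_subset he ⟨e, rfl⟩
    have hb : ∀ e, 0 < e → Touch G Q {c e} → ClosedIn G M {c e}ᶜ := by
      rintro e he ⟨w, hw, _, rfl, hwe⟩
      exact hM _ ⟨e, rfl⟩ (h.branching he hwe.symm (fun h => hQc _ (h ▸ hw))
        (fun h => hQc _ (h ▸ hw)))
    obtain ⟨w, hw, -⟩ := id ti
    have link : ∀ e, Touch G Q {c e} → LinkedIn G (Q ∪ {c e}) w (c e) := by
      rintro e ⟨w', hw', _, rfl, hwe⟩
      exact ((setConn_compIn w hw w' hw').mono Set.subset_union_left).snoc hwe (by simp)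
    have sub : ∀ a b e, (∀ x, a ≤ x → x ≤ b → c x ≠ c e) → c '' Set.Icc a b ∪ Q ⊆ {c e}ᶜ := by
      rintro a b e hne _ (⟨x, ⟨h1, h2⟩, rfl⟩ | hQ) he
      exacts [hne x h1 h2 he, hQc e (he ▸ hQ)]
    refine h.arcChain_mem_of_tripod hij.le hjl.le hl.le (link i ti) (link j tj) (link l tl)
      ((hb l (by omega) tl).anti (sub _ _ _ fun x h1 h2 => ?_))
      ((hb i hi ti).anti (sub _ _ _ fun x h1 h2 => ?_))
      ((hb j (by omega) tj).anti (sub _ _ _ fun x h1 h2 => ?_))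
    · exact h.ne_of_lt (by omega) (by omega)
    · exact (h.ne_of_lt (by omega) (by omega)).symm
    · exact (h.ne_of_lt (by omega) (by omega)).symm
  obtain ⟨i, hi, -, rfl⟩ := h.exists_window hx 1
  obtain ⟨j, hj1, hj2, rfl⟩ := h.exists_window hy i
  obtain ⟨l, hl1, hl2, rfl⟩ := h.exists_window hu i
  have hij : i ≠ j := by rintro rfl; exact hxy rfl
  have hil : i ≠ l := by rintro rfl; exact hxu rfl
  have hjl : j ≠ l := by rintro rfl; exact hyu rfl
  rcases Nat.lt_or_ge j l with h1 | h1
  · exact key i j l (by omega) (by omega) h1 hl2 tx ty tu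
  · exact key i l j (by omega) (by omega) (by omega) hj2 tx tu ty

theorem arcChain_mem [Finite V] (hR : Reduced G) (h : IsCyc G m c)
    (hM : ∀ a ∈ Set.range c, Branching G a → ClosedIn G M {a}ᶜ) : arcChain c 0 m ∈ M := by
  have hm := h.three_le
  obtain ⟨i, hi, hb⟩ : ∃ i, 0 < i ∧ Branching G (c i) := by
    rcases hR.branching_or (h.adj 1) with hb | hb
    exacts [⟨1, by omega, hb⟩, ⟨2, by omega, hb⟩]
  obtain ⟨w, hw, hw1, hw2⟩ := hb (c (i - 1)) (c (i + 1))
  have hwin : ∀ x ∈ Set.range c, x ≠ c i → ∃ k, 0 < k ∧ k < m ∧ x = c (k + i) := by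
    intro x hx hne
    obtain ⟨j, h1, h2, rfl⟩ := h.exists_window hx i
    have : j ≠ i := by rintro rfl; exact hne rfl
    exact ⟨j - i, by omega, by omega, by rw [Nat.sub_add_cancel h1]⟩
  have hs := h.shift i
  have hmi : c (m + i) = c i := by rw [add_comm, h.periodic]
  have fin : ∀ {k S}, 3 ≤ k → k + 3 ≤ m → LinkedIn G S (c i) (c (k + i)) →
      (∀ z ∈ S, z ∈ Set.range c → z = c i ∨ z = c (k + i)) → arcChain c 0 m ∈ M := by
    intro k S h1 h2 hl hSc
    rw [← h.arcChain_shift i]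
    refine hR.arcChain_mem_of_long_link hs (by rwa [h.range_shift]) h1 h2 (S := S)
      (by simpa using hl) ?_
    rw [h.range_shift]
    simpa using hSc
  by_cases hwc : w ∈ Set.range c
  · obtain ⟨k, hk0, hkm, rfl⟩ := hwin w hwc hw.ne'
    have hk1 : k ≠ 1 := by rintro rfl; exact hw2 (by rw [add_comm])
    have hkm1 : k ≠ m - 1 := by
      rintro rfl
      exact hw1 (by rw [show m - 1 + i = i - 1 + m by omega, h.periodic])
    have h1 := hR.add_five_le_of_chord hs (i := 0) (k := k) (by omega) (by omega)
      (by simpa using hw.symm)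
    have h2 := hR.add_five_le_of_chord hs (i := k) (k := m) (by omega) (by omega)
      (by simpa [hmi] using hw)
    exact fin (by omega) (by omega) (LinkedIn.of_adj (S := {c i, c (k + i)}) hw (by simp) (by simp))
      fun z hz _ => hz
  · have hself := mem_compIn_self (G := G) (S := (Set.range c)ᶜ) hwc
    have ti : Touch G (compIn G (Set.range c)ᶜ w) {c i} := ⟨w, hself, _, rfl, hw.symm⟩
    obtain ⟨q, hq, tq, hqi⟩ := hR.exists_attachment_ne h hwc (p := c i) ⟨i, rfl⟩
    by_cases hcon : ∀ x ∈ Set.range c, Touch G (compIn G (Set.range c)ᶜ w) {x} → x = c i ∨ x = q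
    · have hnb := (hR.eq_of_mem_compIn h ⟨i, rfl⟩ hq hcon hwc).2
      have hwq : G.Adj w q := by
        obtain ⟨a, b, hab, ha, hb⟩ := hR.two w
        rcases hnb a ha with rfl | rfl
        · rcases hnb b hb with rfl | rfl
          exacts [absurd rfl hab, hb]
        · exact ha
      obtain ⟨k, hk0, hkm, rfl⟩ := hwin q hq hqi
      have h1 := hR.add_four_le_of_ear hs (i := 0) (k := k) (w := w) (by omega) (by omega)
        (by rwa [h.range_shift]) hwq.symm (by simpa using hw.symm)
      have h2 := hR.add_four_le_of_ear hs (i := k) (k := m) (w := w) (by omega) (by omega)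
        (by rwa [h.range_shift]) (by simpa [hmi] using hw) hwq
      refine fin (k := k) (S := {c i, w, c (k + i)}) (by omega) (by omega)
        ((LinkedIn.of_adj hw (by simp) (by simp)).snoc hwq (by simp)) ?_
      rintro z (rfl | rfl | rfl) hz
      exacts [Or.inl rfl, absurd hz hwc, Or.inr rfl]
    · push Not at hcon
      obtain ⟨x, hx, tx, hxi, hxq⟩ := hcon
      exact arcChain_mem_of_three h hM ⟨i, rfl⟩ hq hx hqi.symm hxi.symm hxq.symm ti tq tx

/-- The peripheral cycles, with one vertex set left out, generate the cycle space. -/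
theorem closedIn_univ [Finite V] (hR : Reduced G) (Z : Set V)
    (hM : ∀ m c, IsPeripheral G m c → Set.range c ≠ Z → arcChain c 0 m ∈ M) :
    ClosedIn G M Set.univ := by
  have all : ∀ m c, IsPeripheral G m c → arcChain c 0 m ∈ M := by
    intro m c hc
    by_cases hZ : Set.range c = Z
    · exact hR.arcChain_mem hc.toIsCyc fun a ha hb => ClosedIn.of_cycles fun l d hd hda =>
        hR.arcChain_mem_of_avoid hb (fun n e he hae => hM n e he fun heZ => hae (heZ ▸ hZ ▸ ha))
          l d hd fun had => hda had rfl
    · exact hM m c hc hZ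
  exact ClosedIn.of_cycles fun m c hc _ => hR.arcChain_mem hc fun a ha hb =>
    ClosedIn.of_cycles fun l d hd hda =>
      hR.arcChain_mem_of_avoid hb (fun n e he _ => all n e he) l d hd fun had => hda had rfl

end Reduced

end Span

section Count

open Classical

variable {V : Type} {G : SimpleGraph V}

theorem card_edgeFinset_le_of_closedIn [Fintype V] (hG : G.Connected)
    (P : Finset (Sym2 V → ZMod 2))
    (hP : ClosedIn G (Submodule.span (ZMod 2) (P : Set (Sym2 V → ZMod 2))) Set.univ) :
    G.edgeFinset.card + 1 ≤ Fintype.card V + P.card := by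
  obtain ⟨T, hTG, hT⟩ := hG.exists_isTree_le
  have hcard := hT.card_edgeFinset
  set F := {e : Sym2 V // e ∈ G.edgeFinset \ T.edgeFinset}
  let ρ : (Sym2 V → ZMod 2) →ₗ[ZMod 2] (F → ZMod 2) := LinearMap.funLeft _ _ Subtype.val
  have htop : Submodule.map ρ (Submodule.span (ZMod 2) (P : Set (Sym2 V → ZMod 2))) = ⊤ := by
    refine le_antisymm le_top ?_
    rw [← (Pi.basisFun (ZMod 2) F).span_eq, Submodule.span_le]
    rintro _ ⟨⟨e, he⟩, rfl⟩
    induction e using Sym2.inductionOn with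
    | hf x y =>
    have hxy : G.Adj x y := by simpa using (Finset.mem_sdiff.1 he).1
    obtain ⟨w⟩ := hT.1 y x
    refine ⟨_, hP (Walk.cons hxy (w.mapLe hTG)) (fun _ _ => trivial), ?_⟩
    have hw : ∀ (l : List (Sym2 V)), (∀ e ∈ l, e ∈ T.edgeSet) → ρ (l.map edgeChain).sum = 0 := by
      intro l hl
      induction l with
      | nil => simp
      | cons a l ih =>
        rw [List.map_cons, List.sum_cons, map_add, ih fun e he => hl e (List.mem_cons_of_mem _ he),
          add_zero]
        funext f
        have hf := (Finset.mem_sdiff.1 f.2).2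
        have ha : a ∈ T.edgeFinset := by simpa using hl a (by simp)
        have : f.1 ≠ a := fun h => hf (h ▸ ha)
        simp [ρ, LinearMap.funLeft, edgeChain, this]
    rw [walkChain_cons, map_add, walkChain, Walk.edges_mapLe_eq_edges,
      hw _ fun e he => w.edges_subset_edgeSet he, add_zero]
    funext f
    simp only [ρ, LinearMap.funLeft, edgeChain, Pi.single_apply, LinearMap.coe_mk, AddHom.coe_mk,
      Function.comp_apply, Pi.basisFun_apply]
    exact if_congr ⟨fun h => Subtype.ext h, fun h => congrArg Subtype.val h⟩ rfl rfl
  have h1 : Module.finrank (ZMod 2) (F → ZMod 2) ≤ P.card := by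
    rw [← finrank_top, ← htop]
    exact (Submodule.finrank_map_le _ _).trans (finrank_span_finset_le_card P)
  rw [Module.finrank_fintype_fun_eq_card, Fintype.card_coe,
    Finset.card_sdiff_of_subset (edgeFinset_mono hTG)] at h1
  omega

theorem IsCyc.card_image_edges {m : ℕ} {c : ℕ → V} (h : IsCyc G m c) :
    ((Finset.range m).image fun l => s(c l, c (l + 1))).card = m := by
  rw [Finset.card_image_of_injOn, Finset.card_range]
  intro i hi j hj hij
  exact h.edge_inj (Finset.mem_range.1 hi) (Finset.mem_range.1 hj) hij

variable [Fintype V]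

theorem IsPeripheral.image_edges {m : ℕ} {c : ℕ → V} (h : IsPeripheral G m c) :
    ((Finset.range m).image fun l => s(c l, c (l + 1))) =
      G.edgeFinset.filter fun e => ∀ x ∈ e, x ∈ Set.range c := by
  have hm := h.three_le
  ext e
  induction e using Sym2.inductionOn with
  | hf x y =>
  simp only [Finset.mem_image, Finset.mem_range, Finset.mem_filter, mem_edgeFinset, mem_edgeSet,
    Sym2.mem_iff, forall_eq_or_imp, forall_eq]
  constructor
  · rintro ⟨l, -, he⟩
    rcases Sym2.eq_iff.1 he with ⟨rfl, rfl⟩ | ⟨rfl, rfl⟩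
    exacts [⟨h.adj l, ⟨_, rfl⟩, ⟨_, rfl⟩⟩, ⟨(h.adj l).symm, ⟨_, rfl⟩, ⟨_, rfl⟩⟩]
  · rintro ⟨hxy, ⟨i, rfl⟩, ⟨j, rfl⟩⟩
    have mod : ∀ i, s(c (i % m), c (i % m + 1)) = s(c i, c (i + 1)) := by
      intro i
      rw [h.map_mod, ← h.map_mod (i % m + 1), Nat.mod_add_mod, h.map_mod]
    rcases h.chordless i j hxy with he | he
    · exact ⟨i % m, Nat.mod_lt _ (by omega), by rw [mod, he]⟩
    · exact ⟨j % m, Nat.mod_lt _ (by omega), by rw [mod, he, Sym2.eq_swap]⟩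

theorem IsPeripheral.arcChain_eq {m : ℕ} {c : ℕ → V} (h : IsPeripheral G m c) :
    arcChain c 0 m =
      ∑ e ∈ G.edgeFinset.filter (fun e => ∀ x ∈ e, x ∈ Set.range c), edgeChain e := by
  rw [← h.image_edges, Finset.sum_image, arcChain, Finset.range_eq_Ico]
  intro i hi j hj hij
  exact h.edge_inj (Finset.mem_range.1 hi) (Finset.mem_range.1 hj) hij

/-- The density bound for the planar graphs to which the cycle space argument applies. -/
theorem Reduced.card_edgeFinset_le [Nonempty V] (hR : Reduced G)
    (hK : ¬ IsMinor (completeBipartiteGraph (Fin 3) (Fin 3)) G)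
    (hK' : ¬ IsMinor (completeGraph (Fin 5)) G) :
    2 * G.edgeFinset.card + 6 ≤ 3 * Fintype.card V := by
  set E : Set V → Finset (Sym2 V) := fun S => G.edgeFinset.filter fun e => ∀ x ∈ e, x ∈ S with hE
  set P : Finset (Set V) := Finset.univ.filter fun S => ∃ m c, IsPeripheral G m c ∧ Set.range c = S
  have hcyc : ∀ Z, G.edgeFinset.card + 1 ≤ Fintype.card V + (P.erase Z).card := by
    intro Z
    refine (card_edgeFinset_le_of_closedIn hR.connected
      ((P.erase Z).image fun S => ∑ e ∈ E S, edgeChain e) (hR.closedIn_univ Z fun m c hc hZ =>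
        Submodule.subset_span ?_)).trans (Nat.add_le_add_left Finset.card_image_le _)
    rw [hc.arcChain_eq]
    exact Finset.mem_coe.2 (Finset.mem_image_of_mem _
      (Finset.mem_erase.2 ⟨hZ, Finset.mem_filter.2 ⟨Finset.mem_univ _, m, c, hc, rfl⟩⟩))
  have hcount : P.card * 6 ≤ G.edgeFinset.card * 2 := by
    refine Finset.card_mul_le_card_mul (fun S e => ∀ x ∈ e, x ∈ S) (fun S hS => ?_)
      (fun e he => ?_)
    · obtain ⟨m, c, hc, rfl⟩ := (Finset.mem_filter.1 hS).2
      rw [Finset.bipartiteAbove, ← hc.image_edges, hc.card_image_edges]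
      exact hR.girth m c hc.toIsCyc
    · by_contra! hcon
      obtain ⟨S₁, h₁, S₂, h₂, S₃, h₃, h12, h13, h23⟩ := Finset.two_lt_card.1 hcon
      simp only [Finset.bipartiteBelow, Finset.mem_filter, P, Finset.mem_univ, true_and] at h₁ h₂ h₃
      obtain ⟨⟨m₁, c₁, hc₁, rfl⟩, h₁⟩ := h₁
      obtain ⟨⟨m₂, c₂, hc₂, rfl⟩, h₂⟩ := h₂
      obtain ⟨⟨m₃, c₃, hc₃, rfl⟩, h₃⟩ := h₃
      induction e using Sym2.inductionOn with
      | hf x y =>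
      exact hc₁.not_three hc₂ hc₃ hK hK' h12 h13 h23 (by simpa using he)
        ⟨h₁ x (by simp), h₂ x (by simp), h₃ x (by simp)⟩
        ⟨h₁ y (by simp), h₂ y (by simp), h₃ y (by simp)⟩
  have h6 := hR.six_le_card
  rcases P.eq_empty_or_nonempty with hP | ⟨Z, hZ⟩
  · have := hcyc ∅
    rw [hP] at this
    simp at this
    omega
  · have h1 := hcyc Z
    have h2 := Finset.card_erase_add_one hZ
    omega

end Count

section Density

variable {V : Type} {G : SimpleGraph V}

/-- The ordered pairs of adjacent vertices in `A`. -/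
def adjPairs (G : SimpleGraph V) (A : Set V) : Set (V × V) :=
  {p | p.1 ∈ A ∧ p.2 ∈ A ∧ G.Adj p.1 p.2}

/-- An upper bound for twice the number of edges of a planar graph of girth at least six with `n`
vertices. -/
def densityBound (n : ℕ) : ℕ := if n ≤ 3 then 2 * (n - 1) else 3 * n - 6

theorem adjPairs_ncard_le_of_leaf [Finite V] {A : Set V} {v : V}
    (h : ∀ x ∈ A, ∀ y ∈ A, G.Adj v x → G.Adj v y → x = y) :
    (adjPairs G A).ncard ≤ (adjPairs G (A \ {v})).ncard + 2 := by
  set N : Set V := {x | x ∈ A ∧ G.Adj v x}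
  have hN : N.ncard ≤ 1 := (Set.ncard_le_one (Set.toFinite N)).2
    fun x hx y hy => h x hx.1 y hy.1 hx.2 hy.2
  have hsub : adjPairs G A ⊆ adjPairs G (A \ {v}) ∪ ((fun x => (v, x)) '' N ∪
      (fun x => (x, v)) '' N) := by
    rintro ⟨x, y⟩ ⟨hx, hy, hxy⟩
    dsimp only at hx hy hxy
    by_cases hxv : x = v
    · subst hxv
      exact Or.inr (Or.inl ⟨y, ⟨hy, hxy⟩, rfl⟩)
    · by_cases hyv : y = v
      · subst hyv
        exact Or.inr (Or.inr ⟨x, ⟨hx, hxy.symm⟩, rfl⟩)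
      · exact Or.inl ⟨⟨hx, hxv⟩, ⟨hy, hyv⟩, hxy⟩
  have h1 := (Set.ncard_le_ncard hsub).trans (Set.ncard_union_le _ _)
  have h2 := Set.ncard_union_le ((fun x => (v, x)) '' N) ((fun x => (x, v)) '' N)
  have h3 : ((fun x => (v, x)) '' N).ncard ≤ N.ncard := Set.ncard_image_le
  have h4 : ((fun x => (x, v)) '' N).ncard ≤ N.ncard := Set.ncard_image_le
  omega

theorem IsCyc.of_induce {A : Set V} {m : ℕ} {c : ℕ → A} (h : IsCyc (G.induce A) m c) :
    IsCyc G m fun i => (c i : V) where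
  three_le := h.three_le
  periodic i := congrArg _ (h.periodic i)
  adj i := h.adj i
  inj i j hi hj hij := h.inj i j hi hj (Subtype.ext hij)

theorem adjPairs_ncard_le_card_edgeFinset [Finite V] (A : Set V)
    [Fintype (G.induce A).edgeSet] :
    (adjPairs G A).ncard ≤ 2 * (G.induce A).edgeFinset.card := by
  classical
  have := Fintype.ofFinite A
  have hsub : adjPairs G A ⊆
      (fun d : (G.induce A).Dart => ((d.fst : V), (d.snd : V))) '' Set.univ := by
    rintro ⟨x, y⟩ ⟨hx, hy, hxy⟩
    exact ⟨⟨(⟨x, hx⟩, ⟨y, hy⟩), hxy⟩, trivial, rfl⟩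
  refine ((Set.ncard_le_ncard hsub).trans Set.ncard_image_le).trans ?_
  rw [Set.ncard_univ, Nat.card_eq_fintype_card, dart_card_eq_twice_card_edges]
  convert le_rfl

/-- Planar graphs of girth at least six are sparse. -/
theorem IsPlanar.adjPairs_ncard_le [Finite V] (hG : IsPlanar G)
    (hg : ∀ m c, IsCyc G m c → 6 ≤ m) (A : Set V) :
    (adjPairs G A).ncard ≤ densityBound A.ncard := by
  classical
  have key : ∀ n, ∀ A : Set V, A.ncard = n → (adjPairs G A).ncard ≤ densityBound n := by
    intro n
    induction n using Nat.strong_induction_on with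
    | _ n ih =>
    intro A hA
    by_contra! hcon
    have hne : A.Nonempty := by
      rw [Set.nonempty_iff_ne_empty]
      rintro rfl
      have : adjPairs G ∅ = ∅ := Set.eq_empty_of_forall_notMem fun p hp => hp.1
      simp [this] at hcon
    have := Fintype.ofFinite A
    have : Nonempty A := hne.to_subtype
    have hR : Reduced (G.induce A) := by
      refine ⟨fun m c h => hg m _ h.of_induce, fun v => ?_, fun p q X hp hq hX => ?_⟩
      · by_contra! hv
        have h1 := adjPairs_ncard_le_of_leaf (G := G) (A := A) (v := v) fun x hx y hy hvx hvy => by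
          by_contra hxy
          exact hv ⟨x, hx⟩ ⟨y, hy⟩ (fun h => hxy (congrArg Subtype.val h)) hvx hvy
        have h2 := Set.ncard_sdiff_singleton_add_one v.2 (Set.toFinite A)
        rcases Nat.lt_or_ge n 2 with hn | hn
        · have h3 : adjPairs G A = ∅ := Set.eq_empty_of_forall_notMem fun p hp => hp.2.2.ne
            ((Set.ncard_le_one (Set.toFinite A)).1 (by omega) _ hp.1 _ hp.2.1)
          rw [h3, Set.ncard_empty] at hcon
          omega
        · have h3 := ih (n - 1) (by omega) (A \ {v.1}) (by omega)
          unfold densityBound at h3 hcon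
          split_ifs at h3 hcon <;> omega
      · by_contra! hs
        have hX2 : 1 < X.ncard := by
          rw [← not_le, Set.ncard_le_one_iff_subsingleton]
          exact Set.not_subsingleton_iff.2 hs.1
        have hY2 : 1 < (X ∪ {p, q})ᶜ.ncard := by
          rw [← not_le, Set.ncard_le_one_iff_subsingleton]
          exact Set.not_subsingleton_iff.2 hs.2
        have hc1 := Set.ncard_add_ncard_compl X
        have hc2 := Set.ncard_add_ncard_compl (X ∪ {p, q})
        have hd : Disjoint X {p, q} := by
          rw [Set.disjoint_right]
          rintro _ (rfl | rfl)
          exacts [hp, hq]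
        rw [Set.ncard_union_eq hd] at hc2
        rw [Nat.card_coe_set_eq, hA] at hc1 hc2
        have hi : ∀ Y : Set A, (Subtype.val '' Y).ncard = Y.ncard :=
          fun Y => Set.ncard_image_of_injective Y Subtype.val_injective
        have hA₁ := (hi (X ∪ {p, q})).trans (Set.ncard_union_eq hd)
        have hA₂ := hi Xᶜ
        have hsub : adjPairs G A ⊆
            adjPairs G (Subtype.val '' (X ∪ {p, q})) ∪ adjPairs G (Subtype.val '' Xᶜ) := by
          rintro ⟨x, y⟩ ⟨hx, hy, hxy⟩
          dsimp only at hx hy hxy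
          by_cases hxX : (⟨x, hx⟩ : A) ∈ X
          · exact Or.inl ⟨⟨_, Or.inl hxX, rfl⟩, ⟨⟨y, hy⟩, hX _ hxX ⟨y, hy⟩ hxy, rfl⟩, hxy⟩
          · by_cases hyX : (⟨y, hy⟩ : A) ∈ X
            · exact Or.inl ⟨⟨⟨x, hx⟩, hX _ hyX ⟨x, hx⟩ hxy.symm, rfl⟩, ⟨_, Or.inl hyX, rfl⟩, hxy⟩
            · exact Or.inr ⟨⟨_, hxX, rfl⟩, ⟨_, hyX, rfl⟩, hxy⟩
        have h1 := (Set.ncard_le_ncard hsub).trans (Set.ncard_union_le _ _)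
        have hpq : ({p, q} : Set A).ncard = 1 ∨ ({p, q} : Set A).ncard = 2 := by
          by_cases h : p = q
          · exact Or.inl (by simp [h])
          · exact Or.inr (Set.ncard_pair h)
        have h2 := ih _ (by omega) _ hA₁
        have h3 := ih _ (by omega) _ hA₂
        unfold densityBound at h2 h3 hcon
        split_ifs at h2 h3 hcon <;> omega
    have h1 := hR.card_edgeFinset_le (fun h => hG.2 h.of_induce) (fun h => hG.1 h.of_induce)
    have h2 := (Nat.add_le_add_right (@adjPairs_ncard_le_card_edgeFinset V G _ A _) 6).trans h1
    have h6 := hR.six_le_card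
    rw [← Nat.card_eq_fintype_card, Nat.card_coe_set_eq, hA] at h2 h6
    unfold densityBound at hcon
    split_ifs at hcon <;> omega
  exact key _ A rfl

theorem IsPlanar.adjPairs_ncard_lt [Finite V] (hG : IsPlanar G)
    (hg : ∀ m c, IsCyc G m c → 6 ≤ m) {A : Set V} (hA : A.Nonempty) :
    (adjPairs G A).ncard < 3 * A.ncard := by
  have h1 := hG.adjPairs_ncard_le hg A
  have h2 := (Set.ncard_pos (Set.toFinite A)).2 hA
  unfold densityBound at h1
  split_ifs at h1 <;> omega

end Density

section Thickness

variable {V : Type} {G : SimpleGraph V}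

theorem not_isMinor_of_edges_eq {W : Type} {H : SimpleGraph W}
    (hG : ∀ a b x y, G.Adj a b → G.Adj x y → s(a, b) = s(x, y)) {u v w : W} (huv : H.Adj u v)
    (huw : H.Adj u w) (hvw : v ≠ w) : ¬ IsMinor H G := by
  rintro ⟨B, -, -, hd, hB⟩
  obtain ⟨a, ha, b, hb, hab⟩ := hB u v huv
  obtain ⟨x, hx, y, hy, hxy⟩ := hB u w huw
  have h : b = x ∨ b = y := by
    rw [← Sym2.mem_iff, ← hG _ _ _ _ hab hxy]
    exact Sym2.mem_mk_right a b
  rcases h with rfl | rfl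
  · exact Set.disjoint_left.1 (hd huv.ne) hx hb
  · exact Set.disjoint_left.1 (hd hvw) hb hy

theorem isPlanar_of_edges_eq (hG : ∀ a b x y, G.Adj a b → G.Adj x y → s(a, b) = s(x, y)) :
    IsPlanar G := by
  constructor
  · exact not_isMinor_of_edges_eq hG (u := 0) (v := 1) (w := 2) (by simp) (by simp) (by decide)
  · exact not_isMinor_of_edges_eq hG (u := Sum.inl 0) (v := Sum.inr 0) (w := Sum.inr 1)
      (by simp) (by simp) (by simp)

theorem thicknessLE_thickness [Fintype V] (G : SimpleGraph V) : ThicknessLE G (thickness G) := by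
  classical
  refine Nat.sInf_mem (s := {t | ThicknessLE G t})
    ⟨Fintype.card (Sym2 V), Fintype.equivFin _, fun i => isPlanar_of_edges_eq ?_⟩
  intro a b x y hab hxy
  rw [fromEdgeSet_adj] at hab hxy
  exact (Fintype.equivFin (Sym2 V)).injective (hab.1.2.trans hxy.1.2.symm)

theorem thickness_pos [Fintype V] [Nonempty V] (G : SimpleGraph V) : 0 < thickness G := by
  obtain ⟨c, -⟩ := thicknessLE_thickness G
  obtain ⟨v⟩ := ‹Nonempty V›
  exact (Nat.zero_le _).trans_lt (c s(v, v)).2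

theorem IsCyc.six_le [Fintype V] (hg : (6 : ℕ∞) ≤ G.egirth) {m : ℕ} {c : ℕ → V}
    (h : IsCyc G m c) : 6 ≤ m := by
  obtain ⟨a, w, hw, rfl⟩ := h.exists_isCycle
  exact_mod_cast le_egirth.1 hg a w hw

theorem ThicknessLE.adjPairs_ncard_lt [Fintype V] {t : ℕ} (h : ThicknessLE G t)
    (hg : (6 : ℕ∞) ≤ G.egirth) {A : Set V} (hA : A.Nonempty) :
    (adjPairs G A).ncard < t * (3 * A.ncard) := by
  classical
  obtain ⟨c, hc⟩ := h
  have hne : Nonempty (Fin t) := ⟨c s(hA.some, hA.some)⟩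
  let K : Fin t → SimpleGraph V := fun i => fromEdgeSet {e | e ∈ G.edgeSet ∧ c e = i}
  have hsub : adjPairs G A ⊆ ⋃ i, adjPairs (K i) A := by
    rintro ⟨x, y⟩ ⟨hx, hy, hxy⟩
    refine Set.mem_iUnion.2 ⟨c s(x, y), hx, hy, ?_⟩
    exact (fromEdgeSet_adj _).2 ⟨⟨hxy, rfl⟩, hxy.ne⟩
  have hK : ∀ i, (adjPairs (K i) A).ncard < 3 * A.ncard := by
    intro i
    have hle : K i ≤ G := by
      intro x y hxy
      exact ((fromEdgeSet_adj _).1 hxy).1.1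
    exact (hc i).adjPairs_ncard_lt (fun m d hd => hd.six_le (hg.trans (egirth_anti hle))) hA
  calc (adjPairs G A).ncard ≤ (⋃ i, adjPairs (K i) A).ncard := Set.ncard_le_ncard hsub
    _ ≤ ∑ i, (adjPairs (K i) A).ncard := Set.ncard_iUnion_le_of_fintype _
    _ < ∑ _i : Fin t, 3 * A.ncard :=
      Finset.sum_lt_sum_of_nonempty Finset.univ_nonempty fun i _ => hK i
    _ = t * (3 * A.ncard) := by simp

theorem IsKConnected.le_deg [Fintype V] {k : ℕ} (h : IsKConnected G k) (v : V) : k ≤ deg G v := by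
  by_contra! hlt
  have hconn := h.2 (G.neighborSet v) hlt
  have hv : v ∈ (G.neighborSet v)ᶜ := by simp
  have huniv : (Set.univ : Set V) ⊆ insert v (G.neighborSet v) := by
    intro w _
    by_contra hw
    rw [Set.mem_insert_iff, not_or] at hw
    have hne : (⟨v, hv⟩ : ↥(G.neighborSet v)ᶜ) ≠ ⟨w, hw.2⟩ := by
      simpa using Ne.symm hw.1
    have : Nontrivial ↥(G.neighborSet v)ᶜ := ⟨_, _, hne⟩
    obtain ⟨u, hu⟩ := hconn.preconnected.exists_adj_of_nontrivial ⟨v, hv⟩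
    exact u.2 hu
  have h1 := (Set.ncard_le_ncard huniv).trans (Set.ncard_insert_le _ _)
  rw [Set.ncard_univ, Nat.card_eq_fintype_card] at h1
  have h2 := h.1
  unfold deg at hlt
  omega

end Thickness

section Discharging

variable {V : Type} {G : SimpleGraph V}

open Classical in
theorem adjPairs_ncard_eq_sum (A : Finset V) :
    (adjPairs G A).ncard = ∑ x ∈ A, (A.filter fun y => G.Adj x y).card := by
  rw [← Finset.card_sigma, ← Set.ncard_coe_finset]
  refine Set.ncard_congr (fun p _ => ⟨p.1, p.2⟩) ?_ ?_ ?_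
  · rintro ⟨x, y⟩ ⟨hx, hy, hxy⟩
    simpa using ⟨hx, hy, hxy⟩
  · rintro ⟨x, y⟩ ⟨x', y'⟩ - - h
    simpa using h
  · rintro ⟨x, y⟩ h
    obtain ⟨hx, hy, hxy⟩ : x ∈ A ∧ y ∈ A ∧ G.Adj x y := by simpa using h
    exact ⟨(x, y), ⟨hx, hy, hxy⟩, rfl⟩

open Classical in
theorem exists_coloringCost_lt [Fintype V] {t : ℕ} (hdeg : ∀ v, 2 * t - 1 ≤ deg G v)
    (hdens : ∀ A : Set V, A.Nonempty → (adjPairs G A).ncard < t * (3 * A.ncard))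
    {R : Finset V} (hR : R.Nonempty) : ∃ v ∈ R, coloringCost G R v < 6 * t := by
  by_contra! hcon
  let X : Finset V :=
    Finset.univ.filter fun u => (Even (deg G u) ∧ ∀ w, G.Adj u w → w ∈ R) ∧ u ∉ R
  let e : Finset V → Finset V → ℕ := fun A B => ∑ x ∈ A, (B.filter fun y => G.Adj x y).card
  have hdisj : Disjoint R X := by
    rw [Finset.disjoint_left]
    intro u hu hX
    exact (Finset.mem_filter.1 hX).2.2 hu
  have hcost : R.card * (6 * t) ≤ 2 * e R R + e R X := by
    calc R.card * (6 * t) ≤ ∑ v ∈ R, coloringCost G R v := by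
          simpa using Finset.card_nsmul_le_sum R _ _ hcon
      _ ≤ ∑ v ∈ R, (2 * (R.filter fun u => G.Adj v u).card +
            (X.filter fun u => G.Adj v u).card) := by
          refine Finset.sum_le_sum fun v _ => ?_
          have hsub : (Finset.univ.filter fun u =>
              G.Adj v u ∧ Even (deg G u) ∧ ∀ w, G.Adj u w → w ∈ R) ⊆
              (R.filter fun u => G.Adj v u) ∪ (X.filter fun u => G.Adj v u) := by
            intro u hu
            simp only [Finset.mem_filter, Finset.mem_univ, true_and, Finset.mem_union, X] at hu ⊢
            tauto
          have := (Finset.card_le_card hsub).trans (Finset.card_union_le _ _)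
          unfold coloringCost
          omega
      _ = 2 * e R R + e R X := by rw [Finset.sum_add_distrib, ← Finset.mul_sum]
  have hcomm : e X R = e R X := by
    have := Finset.sum_card_bipartiteAbove_eq_sum_card_bipartiteBelow (s := X) (t := R) G.Adj
    simpa only [Finset.bipartiteAbove, Finset.bipartiteBelow, G.adj_comm] using this
  have hXdeg : X.card * (2 * t) ≤ e X R := by
    rw [← smul_eq_mul]
    refine Finset.card_nsmul_le_sum X _ _ fun u hu => ?_
    obtain ⟨⟨hev, hN⟩, -⟩ := (Finset.mem_filter.1 hu).2
    have hd : deg G u = (R.filter fun y => G.Adj u y).card := by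
      rw [deg, ← Set.ncard_coe_finset]
      congr 1
      ext w
      simpa using hN w
    rw [← hd]
    have := hdeg u
    obtain ⟨m, hm⟩ := hev
    omega
  have hsplit : e R R + 2 * e R X ≤ (adjPairs G (R ∪ X : Finset V)).ncard := by
    have hadd : ∀ x, ((R ∪ X).filter fun y => G.Adj x y).card =
        (R.filter fun y => G.Adj x y).card + (X.filter fun y => G.Adj x y).card := by
      intro x
      rw [Finset.filter_union, Finset.card_union_of_disjoint (Finset.disjoint_filter_filter hdisj)]
    rw [adjPairs_ncard_eq_sum, Finset.sum_union hdisj]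
    simp only [hadd, Finset.sum_add_distrib]
    change e R R + 2 * e R X ≤ e R R + e R X + (e X R + e X X)
    omega
  have hlt := hdens (R ∪ X : Finset V) (Finset.coe_nonempty.2 hR.inl)
  rw [Set.ncard_coe_finset, Finset.card_union_of_disjoint hdisj] at hlt
  nlinarith

end Discharging

/-- A `(2θ(G) − 1)`-connected graph with girth at least 6 satisfies `χ_o(G) ≤ 6θ(G)`. -/
theorem oddChrom_le_six_thickness_of_connected {V : Type} [Fintype V] (G : SimpleGraph V)
    (hc : IsKConnected G (2 * thickness G - 1))
    (hg : (6 : ℕ∞) ≤ G.egirth) :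
    oddChrom G ≤ 6 * thickness G := by
  have : Nonempty V := Fintype.card_pos_iff.1 ((Nat.zero_le _).trans_lt hc.1)
  have ht := thickness_pos G
  exact Nat.sInf_le (exists_isOddColoring G (by omega) fun R hR =>
    exists_coloringCost_lt hc.le_deg
      (fun A hA => (thicknessLE_thickness G).adjPairs_ncard_lt hg hA) hR)
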